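/- arXiv:2012.08370 — 3 statements merged into one kernel-verified Lean document; each statement's English description precedes it below -/
import Mathlib

section
/- For every valid signature Σ, the category CwF_Σ of small cwfs with a Σ-structure and strict cwf-morphisms preserving the Σ-structure has an initial object T_Σ. -/
universe u v w x u' v' w' x'

/-- A category with families (cwf): a category of contexts and substitutions,
a `Fam`-valued presheaf of types and terms, a chosen terminal object, and
context comprehension. -/
structure CwF where
  Ctx : Type u
  Hom : Ctx → Ctx → Type v
  id : (Γ : Ctx) → Hom Γ Γ
  comp : {Ξ Δ Γ : Ctx} → Hom Δ Γ → Hom Ξ Δ → Hom Ξ Γ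
  id_comp : ∀ {Δ Γ : Ctx} (γ : Hom Δ Γ), comp (id Γ) γ = γ
  comp_id : ∀ {Δ Γ : Ctx} (γ : Hom Δ Γ), comp γ (id Δ) = γ
  comp_assoc : ∀ {Θ Ξ Δ Γ : Ctx} (γ : Hom Δ Γ) (δ : Hom Ξ Δ) (ξ : Hom Θ Ξ),
    comp (comp γ δ) ξ = comp γ (comp δ ξ)
  Ty : Ctx → Type w
  Tm : (Γ : Ctx) → Ty Γ → Type x
  subTy : {Δ Γ : Ctx} → Ty Γ → Hom Δ Γ → Ty Δ
  subTm : {Δ Γ : Ctx} → {A : Ty Γ} → Tm Γ A → (γ : Hom Δ Γ) → Tm Δ (subTy A γ)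
  subTy_id : ∀ {Γ : Ctx} (A : Ty Γ), subTy A (id Γ) = A
  subTy_comp : ∀ {Ξ Δ Γ : Ctx} (A : Ty Γ) (γ : Hom Δ Γ) (δ : Hom Ξ Δ),
    subTy A (comp γ δ) = subTy (subTy A γ) δ
  subTm_id : ∀ {Γ : Ctx} {A : Ty Γ} (a : Tm Γ A), HEq (subTm a (id Γ)) a
  subTm_comp : ∀ {Ξ Δ Γ : Ctx} {A : Ty Γ} (a : Tm Γ A) (γ : Hom Δ Γ) (δ : Hom Ξ Δ),
    HEq (subTm a (comp γ δ)) (subTm (subTm a γ) δ)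
  one : Ctx
  bang : (Γ : Ctx) → Hom Γ one
  bang_unique : ∀ {Γ : Ctx} (γ : Hom Γ one), γ = bang Γ
  ext : (Γ : Ctx) → Ty Γ → Ctx
  p : {Γ : Ctx} → (A : Ty Γ) → Hom (ext Γ A) Γ
  q : {Γ : Ctx} → (A : Ty Γ) → Tm (ext Γ A) (subTy A (p A))
  pair : {Δ Γ : Ctx} → (A : Ty Γ) → (γ : Hom Δ Γ) → Tm Δ (subTy A γ) → Hom Δ (ext Γ A)
  p_pair : ∀ {Δ Γ : Ctx} (A : Ty Γ) (γ : Hom Δ Γ) (a : Tm Δ (subTy A γ)),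
    comp (p A) (pair A γ a) = γ
  q_pair : ∀ {Δ Γ : Ctx} (A : Ty Γ) (γ : Hom Δ Γ) (a : Tm Δ (subTy A γ)),
    HEq (subTm (q A) (pair A γ a)) a
  pair_unique : ∀ {Δ Γ : Ctx} (A : Ty Γ) (γ : Hom Δ Γ) (a : Tm Δ (subTy A γ))
    (δ : Hom Δ (ext Γ A)), comp (p A) δ = γ → HEq (subTm (q A) δ) a → δ = pair A γ a

/-- A strict cwf-morphism: a functor together with a natural transformation of
`Fam`-valued presheaves, preserving the terminal object and context comprehension
on the nose. -/
structure CwFHom (C : CwF.{u, v, w, x}) (D : CwF.{u', v', w', x'}) where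
  obj : C.Ctx → D.Ctx
  map : {Δ Γ : C.Ctx} → C.Hom Δ Γ → D.Hom (obj Δ) (obj Γ)
  map_id : ∀ Γ : C.Ctx, map (C.id Γ) = D.id (obj Γ)
  map_comp : ∀ {Ξ Δ Γ : C.Ctx} (γ : C.Hom Δ Γ) (δ : C.Hom Ξ Δ),
    map (C.comp γ δ) = D.comp (map γ) (map δ)
  mapTy : {Γ : C.Ctx} → C.Ty Γ → D.Ty (obj Γ)
  mapTm : {Γ : C.Ctx} → {A : C.Ty Γ} → C.Tm Γ A → D.Tm (obj Γ) (mapTy A)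
  mapTy_sub : ∀ {Δ Γ : C.Ctx} (A : C.Ty Γ) (γ : C.Hom Δ Γ),
    mapTy (C.subTy A γ) = D.subTy (mapTy A) (map γ)
  mapTm_sub : ∀ {Δ Γ : C.Ctx} {A : C.Ty Γ} (a : C.Tm Γ A) (γ : C.Hom Δ Γ),
    HEq (mapTm (C.subTm a γ)) (D.subTm (mapTm a) (map γ))
  obj_one : obj C.one = D.one
  obj_ext : ∀ {Γ : C.Ctx} (A : C.Ty Γ), obj (C.ext Γ A) = D.ext (obj Γ) (mapTy A)
  map_p : ∀ {Γ : C.Ctx} (A : C.Ty Γ), HEq (map (C.p A)) (D.p (mapTy A))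
  map_q : ∀ {Γ : C.Ctx} (A : C.Ty Γ), HEq (mapTm (C.q A)) (D.q (mapTy A))

/-- A "category of cwfs with structure": a collection of objects, each with an
underlying small cwf, together with a predicate singling out which strict
cwf-morphisms of underlying cwfs are structure-preserving morphisms.
The categories `CwF_Σ` of cwfs with a `Σ`-structure are of this shape. -/
structure SigCat : Type (u + 2) where
  Obj : Type (u + 1)
  cwf : Obj → CwF.{u, u, u, u}
  Mor : (C D : Obj) → CwFHom (cwf C) (cwf D) → Prop

/-- A uniform family of contexts: a choice of context `Γ_C` in each cwf with
structure `C`, preserved on the nose by all structure-preserving morphisms. -/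
structure UnifCtx (S : SigCat.{u}) : Type (u + 1) where
  fam : (C : S.Obj) → (S.cwf C).Ctx
  uniform : ∀ {C D : S.Obj} (F : CwFHom (S.cwf C) (S.cwf D)),
    S.Mor C D F → F.obj (fam C) = fam D

/-- A uniform family of types over a uniform family of contexts. -/
structure UnifTy (S : SigCat.{u}) (Γ : UnifCtx S) : Type (u + 1) where
  fam : (C : S.Obj) → (S.cwf C).Ty (Γ.fam C)
  uniform : ∀ {C D : S.Obj} (F : CwFHom (S.cwf C) (S.cwf D)),
    S.Mor C D F → HEq (F.mapTy (fam C)) (fam D)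

/-- A uniform family of terms of a uniform family of types. -/
structure UnifTm (S : SigCat.{u}) (Γ : UnifCtx S) (A : UnifTy S Γ) : Type (u + 1) where
  fam : (C : S.Obj) → (S.cwf C).Tm (Γ.fam C) (A.fam C)
  uniform : ∀ {C D : S.Obj} (F : CwFHom (S.cwf C) (S.cwf D)),
    S.Mor C D F → HEq (F.mapTm (fam C)) (fam D)

/-- The category of models of the empty signature: `CwF_∅ = CwF`. -/
def SigCat.empty : SigCat.{u} where
  Obj := CwF.{u, u, u, u}
  cwf := fun C => C
  Mor := fun _ _ _ => True

/-- Extending a signature by a new sort symbol `S` relative to a uniform family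
of contexts `Γ`: objects are pairs `(C, S_C)` with `S_C ∈ Ty_C(Γ_C)`, and
morphisms are those `F` with `F(S_C) = S_D`. -/
def SigCat.addSort (S : SigCat.{u}) (Γ : UnifCtx S) : SigCat.{u} where
  Obj := Σ C : S.Obj, (S.cwf C).Ty (Γ.fam C)
  cwf := fun C => S.cwf C.1
  Mor := fun C D F => S.Mor C.1 D.1 F ∧ HEq (F.mapTy C.2) D.2

/-- Extending a signature by a new operator symbol `f` relative to a uniform
family of contexts `Γ` and a uniform family of types `A`: objects are pairs
`(C, f_C)` with `f_C ∈ Tm_C(Γ_C, A_C)`, and morphisms are those `F` with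
`F(f_C) = f_D`. -/
def SigCat.addOp (S : SigCat.{u}) (Γ : UnifCtx S) (A : UnifTy S Γ) : SigCat.{u} where
  Obj := Σ C : S.Obj, (S.cwf C).Tm (Γ.fam C) (A.fam C)
  cwf := fun C => S.cwf C.1
  Mor := fun C D F => S.Mor C.1 D.1 F ∧ HEq (F.mapTm C.2) D.2

/-- Extending a signature by a new equation `a = a'` between uniform families
of terms: the full subcategory of objects `C` with `a_C = a'_C`. -/
def SigCat.addEq (S : SigCat.{u}) (Γ : UnifCtx S) (A : UnifTy S Γ)
    (a a' : UnifTm S Γ A) : SigCat.{u} where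
  Obj := { C : S.Obj // a.fam C = a'.fam C }
  cwf := fun C => S.cwf C.1
  Mor := fun C D F => S.Mor C.1 D.1 F

/-- Valid signatures, presented via their categories of models: the inductive
closure of `CwF_∅ = CwF` under extension by sort symbols, operator symbols and
equations relative to uniform families. -/
inductive SigCat.Valid : SigCat.{u} → Prop
  | empty : SigCat.Valid SigCat.empty
  | addSort (S : SigCat.{u}) (Γ : UnifCtx S) :
      SigCat.Valid S → SigCat.Valid (S.addSort Γ)
  | addOp (S : SigCat.{u}) (Γ : UnifCtx S) (A : UnifTy S Γ) :
      SigCat.Valid S → SigCat.Valid (S.addOp Γ A)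
  | addEq (S : SigCat.{u}) (Γ : UnifCtx S) (A : UnifTy S Γ) (a a' : UnifTm S Γ A) :
      SigCat.Valid S → SigCat.Valid (S.addEq Γ A a a')

/-- `I` is an initial object of the category of cwfs with structure `S`:
to every object there is a unique structure-preserving strict cwf-morphism
from `I`. -/
def SigCat.IsInitial (S : SigCat.{u}) (I : S.Obj) : Prop :=
  ∀ C : S.Obj, ∃! F : CwFHom (S.cwf I) (S.cwf C), S.Mor I C F

namespace SigInit

inductive Elt (C : CwF.{u, u, u, u}) : Type u
  | ctx (Γ : C.Ctx) : Elt C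
  | hom (Δ Γ : C.Ctx) (γ : C.Hom Δ Γ) : Elt C
  | ty (Γ : C.Ctx) (A : C.Ty Γ) : Elt C
  | tm (Γ : C.Ctx) (A : C.Ty Γ) (a : C.Tm Γ A) : Elt C

section EltLemmas
variable {C : CwF.{u, u, u, u}}

theorem hom_ext {Δ Γ Δ' Γ' : C.Ctx} {γ : C.Hom Δ Γ} {γ' : C.Hom Δ' Γ'}
    (h1 : Δ = Δ') (h2 : Γ = Γ') (h : HEq γ γ') : Elt.hom Δ Γ γ = Elt.hom Δ' Γ' γ' := by
  subst h1 h2; cases h; rfl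

theorem ty_ext {Γ Γ' : C.Ctx} {A : C.Ty Γ} {A' : C.Ty Γ'}
    (h1 : Γ = Γ') (h : HEq A A') : Elt.ty Γ A = Elt.ty Γ' A' := by
  subst h1; cases h; rfl

theorem tm_ext {Γ Γ' : C.Ctx} {A : C.Ty Γ} {A' : C.Ty Γ'} {a : C.Tm Γ A} {a' : C.Tm Γ' A'}
    (h1 : Γ = Γ') (h2 : HEq A A') (h : HEq a a') : Elt.tm Γ A a = Elt.tm Γ' A' a' := by
  subst h1; cases h2; cases h; rfl

theorem hom_inj {Δ Γ : C.Ctx} {γ γ' : C.Hom Δ Γ} (h : Elt.hom Δ Γ γ = Elt.hom Δ Γ γ') :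
    γ = γ' := by cases h; rfl
theorem ty_inj {Γ : C.Ctx} {A A' : C.Ty Γ} (h : Elt.ty Γ A = Elt.ty Γ A') : A = A' := by
  cases h; rfl
theorem hom_heq {Δ Γ Δ' Γ' : C.Ctx} {γ : C.Hom Δ Γ} {γ' : C.Hom Δ' Γ'}
    (h : Elt.hom Δ Γ γ = Elt.hom Δ' Γ' γ') : HEq γ γ' := by cases h; rfl
theorem ty_heq {Γ Γ' : C.Ctx} {A : C.Ty Γ} {A' : C.Ty Γ'}
    (h : Elt.ty Γ A = Elt.ty Γ' A') : HEq A A' := by cases h; rfl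
theorem tm_heq {Γ Γ' : C.Ctx} {A : C.Ty Γ} {A' : C.Ty Γ'} {a : C.Tm Γ A} {a' : C.Tm Γ' A'}
    (h : Elt.tm Γ A a = Elt.tm Γ' A' a') : HEq a a' := by cases h; rfl
theorem tm_ty {Γ Γ' : C.Ctx} {A : C.Ty Γ} {A' : C.Ty Γ'} {a : C.Tm Γ A} {a' : C.Tm Γ' A'}
    (h : Elt.tm Γ A a = Elt.tm Γ' A' a') : Elt.ty Γ A = Elt.ty Γ' A' := by cases h; rfl

theorem comp_congr {Ξ Δ Γ Ξ' Δ' Γ' : C.Ctx} {γ : C.Hom Δ Γ} {δ : C.Hom Ξ Δ}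
    {γ' : C.Hom Δ' Γ'} {δ' : C.Hom Ξ' Δ'}
    (h1 : Elt.hom _ _ γ = Elt.hom _ _ γ') (h2 : Elt.hom _ _ δ = Elt.hom _ _ δ') :
    Elt.hom _ _ (C.comp γ δ) = Elt.hom _ _ (C.comp γ' δ') := by
  cases h1; cases h2; rfl

theorem subTy_congr {Δ Γ Δ' Γ' : C.Ctx} {γ : C.Hom Δ Γ} {A : C.Ty Γ}
    {γ' : C.Hom Δ' Γ'} {A' : C.Ty Γ'}
    (h1 : Elt.ty _ A = Elt.ty _ A') (h2 : Elt.hom _ _ γ = Elt.hom _ _ γ') :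
    Elt.ty _ (C.subTy A γ) = Elt.ty _ (C.subTy A' γ') := by
  cases h1; cases h2; rfl

theorem subTm_congr {Δ Γ Δ' Γ' : C.Ctx} {γ : C.Hom Δ Γ} {A : C.Ty Γ} {a : C.Tm Γ A}
    {γ' : C.Hom Δ' Γ'} {A' : C.Ty Γ'} {a' : C.Tm Γ' A'}
    (h1 : Elt.tm _ _ a = Elt.tm _ _ a') (h2 : Elt.hom _ _ γ = Elt.hom _ _ γ') :
    Elt.tm _ _ (C.subTm a γ) = Elt.tm _ _ (C.subTm a' γ') := by
  cases h1; cases h2; rfl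

theorem pair_congr {Δ Γ Δ' Γ' : C.Ctx} {A : C.Ty Γ} {A' : C.Ty Γ'} {γ : C.Hom Δ Γ}
    {γ' : C.Hom Δ' Γ'} {a : C.Tm Δ (C.subTy A γ)} {a' : C.Tm Δ' (C.subTy A' γ')}
    (h1 : Elt.ty _ A = Elt.ty _ A') (h2 : Elt.hom _ _ γ = Elt.hom _ _ γ')
    (h3 : Elt.tm _ _ a = Elt.tm _ _ a') :
    Elt.hom _ _ (C.pair A γ a) = Elt.hom _ _ (C.pair A' γ' a') := by
  cases h1; cases h2; cases h3; rfl

theorem exists_hom {Δ Γ Δ' Γ' : C.Ctx} (γ : C.Hom Δ Γ) (h1 : Δ = Δ') (h2 : Γ = Γ') :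
    ∃ γ' : C.Hom Δ' Γ', Elt.hom _ _ γ' = Elt.hom _ _ γ := by
  subst h1 h2; exact ⟨_, rfl⟩

theorem exists_tm {Γ Γ' : C.Ctx} {A : C.Ty Γ} {A' : C.Ty Γ'} (a : C.Tm Γ A)
    (h : Elt.ty _ A = Elt.ty _ A') :
    ∃ a' : C.Tm Γ' A', Elt.tm _ _ a' = Elt.tm _ _ a := by
  cases h; exact ⟨_, rfl⟩

theorem exists_ty {Γ Γ' : C.Ctx} (A : C.Ty Γ) (h : Γ = Γ') :
    ∃ A' : C.Ty Γ', Elt.ty _ A' = Elt.ty _ A := by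
  cases h; exact ⟨_, rfl⟩

end EltLemmas

/-- Action of a strict morphism on elements. -/
def elt {C D : CwF.{u, u, u, u}} (F : CwFHom C D) : Elt C → Elt D
  | .ctx Γ => .ctx (F.obj Γ)
  | .hom _ _ γ => .hom _ _ (F.map γ)
  | .ty _ A => .ty _ (F.mapTy A)
  | .tm _ _ a => .tm _ _ (F.mapTm a)

theorem cwfHom_ext {C D : CwF.{u, u, u, u}} (F G : CwFHom C D) (h : ∀ e, elt F e = elt G e) :
    F = G := by
  obtain ⟨obj, map, _, _, mapTy, mapTm, _, _, _, _, _, _⟩ := F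
  obtain ⟨obj', map', _, _, mapTy', mapTm', _, _, _, _, _, _⟩ := G
  have h1 : obj = obj' := by
    funext Γ
    have := h (.ctx Γ)
    simpa [elt] using this
  subst h1
  have h2 : @map = @map' := by
    funext Δ Γ γ
    exact hom_inj (h (.hom _ _ γ))
  subst h2
  have h3 : @mapTy = @mapTy' := by
    funext Γ A
    exact ty_inj (h (.ty _ A))
  subst h3
  have h4 : @mapTm = @mapTm' := by
    funext Γ A a
    exact eq_of_heq (tm_heq (h (.tm _ _ a)))
  subst h4
  rfl

/-- Raw expressions over a type of constants. -/
inductive Raw (K : Type u) : Type u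
  | const (k : K) : Raw K
  | id (r : Raw K) : Raw K
  | comp (r s : Raw K) : Raw K
  | subTy (r s : Raw K) : Raw K
  | subTm (r s : Raw K) : Raw K
  | one : Raw K
  | bang (r : Raw K) : Raw K
  | ext (r : Raw K) : Raw K
  | p (r : Raw K) : Raw K
  | q (r : Raw K) : Raw K
  | pair (r s t : Raw K) : Raw K
  | tyCtx (r : Raw K) : Raw K
  | tmTy (r : Raw K) : Raw K

/-- Evaluation of raw expressions in a cwf with constants. -/
inductive Ev {K : Type u} (C : CwF.{u, u, u, u}) (c : K → Elt C) : Raw K → Elt C → Prop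
  | const (k : K) : Ev C c (.const k) (c k)
  | id {r Γ} : Ev C c r (.ctx Γ) → Ev C c (.id r) (.hom _ _ (C.id Γ))
  | comp {r s Ξ Δ Γ} {γ : C.Hom Δ Γ} {δ : C.Hom Ξ Δ} :
      Ev C c r (.hom _ _ γ) → Ev C c s (.hom _ _ δ) → Ev C c (.comp r s) (.hom _ _ (C.comp γ δ))
  | subTy {r s Δ Γ} {A : C.Ty Γ} {γ : C.Hom Δ Γ} :
      Ev C c r (.ty _ A) → Ev C c s (.hom _ _ γ) → Ev C c (.subTy r s) (.ty _ (C.subTy A γ))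
  | subTm {r s Δ Γ} {A : C.Ty Γ} {a : C.Tm Γ A} {γ : C.Hom Δ Γ} :
      Ev C c r (.tm _ _ a) → Ev C c s (.hom _ _ γ) → Ev C c (.subTm r s) (.tm _ _ (C.subTm a γ))
  | one : Ev C c .one (.ctx C.one)
  | bang {r Γ} : Ev C c r (.ctx Γ) → Ev C c (.bang r) (.hom _ _ (C.bang Γ))
  | ext {r Γ} {A : C.Ty Γ} : Ev C c r (.ty _ A) → Ev C c (.ext r) (.ctx (C.ext Γ A))
  | p {r Γ} {A : C.Ty Γ} : Ev C c r (.ty _ A) → Ev C c (.p r) (.hom _ _ (C.p A))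
  | q {r Γ} {A : C.Ty Γ} : Ev C c r (.ty _ A) → Ev C c (.q r) (.tm _ _ (C.q A))
  | pair {r s t Δ Γ} {A : C.Ty Γ} {γ : C.Hom Δ Γ} {a : C.Tm Δ (C.subTy A γ)} :
      Ev C c r (.ty _ A) → Ev C c s (.hom _ _ γ) → Ev C c t (.tm _ _ a) →
      Ev C c (.pair r s t) (.hom _ _ (C.pair A γ a))
  | tyCtx {r Γ} {A : C.Ty Γ} : Ev C c r (.ty _ A) → Ev C c (.tyCtx r) (.ctx Γ)
  | tmTy {r Γ} {A : C.Ty Γ} {a : C.Tm Γ A} : Ev C c r (.tm _ _ a) → Ev C c (.tmTy r) (.ty _ A)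

theorem Ev.fn {K : Type u} {C : CwF.{u, u, u, u}} {c : K → Elt C} {r : Raw K} {e : Elt C}
    (h : Ev C c r e) : ∀ {e' : Elt C}, Ev C c r e' → e = e' := by
  induction h with
  | const k => intro e' h; cases h; rfl
  | id _ ih => intro e' h; cases h with | id h1 => cases ih h1; rfl
  | comp _ _ ih1 ih2 =>
    intro e' h; cases h with | comp h1 h2 => exact comp_congr (ih1 h1) (ih2 h2)
  | subTy _ _ ih1 ih2 =>
    intro e' h; cases h with | subTy h1 h2 => exact subTy_congr (ih1 h1) (ih2 h2)
  | subTm _ _ ih1 ih2 =>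
    intro e' h; cases h with | subTm h1 h2 => exact subTm_congr (ih1 h1) (ih2 h2)
  | one => intro e' h; cases h; rfl
  | bang _ ih => intro e' h; cases h with | bang h1 => cases ih h1; rfl
  | ext _ ih => intro e' h; cases h with | ext h1 => cases ih h1; rfl
  | p _ ih => intro e' h; cases h with | p h1 => cases ih h1; rfl
  | q _ ih => intro e' h; cases h with | q h1 => cases ih h1; rfl
  | pair _ _ _ ih1 ih2 ih3 =>
    intro e' h; cases h with | pair h1 h2 h3 => exact pair_congr (ih1 h1) (ih2 h2) (ih3 h3)
  | tyCtx _ ih => intro e' h; cases h with | tyCtx h1 => cases ih h1; rfl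
  | tmTy _ ih => intro e' h; cases h with | tmTy h1 => cases ih h1; rfl

section Pres
variable {C D : CwF.{u, u, u, u}} (F : CwFHom C D)

theorem elt_p {Γ : C.Ctx} (A : C.Ty Γ) :
    elt F (.hom _ _ (C.p A)) = .hom _ _ (D.p (F.mapTy A)) :=
  hom_ext (F.obj_ext A) rfl (F.map_p A)

theorem elt_q {Γ : C.Ctx} (A : C.Ty Γ) :
    elt F (.tm _ _ (C.q A)) = .tm _ _ (D.q (F.mapTy A)) := by
  refine tm_ext (F.obj_ext A) ?_ (F.map_q A)
  rw [F.mapTy_sub]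
  exact ty_heq (subTy_congr rfl (elt_p F A))

theorem elt_subTm {Δ Γ : C.Ctx} {A : C.Ty Γ} (a : C.Tm Γ A) (γ : C.Hom Δ Γ) :
    elt F (.tm _ _ (C.subTm a γ)) = .tm _ _ (D.subTm (F.mapTm a) (F.map γ)) :=
  tm_ext rfl (heq_of_eq (F.mapTy_sub A γ)) (F.mapTm_sub a γ)

theorem pair_unique' {Δ Γ : D.Ctx} (A : D.Ty Γ) (γ : D.Hom Δ Γ) (a : D.Tm Δ (D.subTy A γ))
    {Θ : D.Ctx} (hΘ : Θ = D.ext Γ A) (δ : D.Hom Δ Θ) (π : D.Hom Θ Γ)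
    (hπ : Elt.hom _ _ π = Elt.hom _ _ (D.p A)) (T : D.Ty Θ) (t : D.Tm Θ T)
    (ht : Elt.tm _ _ t = Elt.tm _ _ (D.q A))
    (h1 : D.comp π δ = γ) (h2 : Elt.tm _ _ (D.subTm t δ) = Elt.tm _ _ a) :
    Elt.hom _ _ δ = Elt.hom _ _ (D.pair A γ a) := by
  subst hΘ
  cases hπ
  cases ht
  rw [D.pair_unique A γ a δ h1 (tm_heq h2)]

theorem elt_pair {Δ Γ : C.Ctx} (A : C.Ty Γ) (γ : C.Hom Δ Γ) (a : C.Tm Δ (C.subTy A γ))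
    (a' : D.Tm (F.obj Δ) (D.subTy (F.mapTy A) (F.map γ)))
    (h : Elt.tm _ _ a' = Elt.tm _ _ (F.mapTm a)) :
    elt F (.hom _ _ (C.pair A γ a)) = .hom _ _ (D.pair (F.mapTy A) (F.map γ) a') := by
  refine pair_unique' _ _ _ (F.obj_ext A) _ _ (elt_p F A) _ _ (elt_q F A) ?_ ?_
  · rw [← F.map_comp, C.p_pair]
  · rw [h, ← elt_subTm]
    refine congrArg (elt F) (tm_ext rfl ?_ (C.q_pair A γ a))
    rw [← C.subTy_comp, C.p_pair]

theorem Ev.map {K : Type u} {c : K → Elt C} {d : K → Elt D} (hc : ∀ k, elt F (c k) = d k)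
    {r : Raw K} {e : Elt C} (h : Ev C c r e) : Ev D d r (elt F e) := by
  induction h with
  | const k => rw [hc]; exact .const k
  | id _ ih => simp only [elt, F.map_id]; exact .id ih
  | comp _ _ ih1 ih2 => simp only [elt, F.map_comp]; exact .comp ih1 ih2
  | subTy _ _ ih1 ih2 => simp only [elt, F.mapTy_sub]; exact .subTy ih1 ih2
  | subTm _ _ ih1 ih2 => rw [elt_subTm]; exact .subTm ih1 ih2
  | one => simp only [elt, F.obj_one]; exact .one
  | @bang r Γ _ ih =>
    have : elt F (.hom _ _ (C.bang Γ)) = .hom _ _ (D.bang (F.obj Γ)) := by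
      obtain ⟨b, hb⟩ := exists_hom (F.map (C.bang Γ)) rfl F.obj_one
      rw [elt, ← hb, D.bang_unique b]
    rw [this]; exact .bang ih
  | ext _ ih => simp only [elt, F.obj_ext]; exact .ext ih
  | p _ ih => rw [elt_p]; exact .p ih
  | q _ ih => rw [elt_q]; exact .q ih
  | @pair r s t Δ Γ A γ a _ _ _ ih1 ih2 ih3 =>
    obtain ⟨a', ha'⟩ := exists_tm (F.mapTm a) (congrArg (Elt.ty _) (F.mapTy_sub A γ))
    rw [elt_pair F A γ a a' ha']
    refine .pair ih1 ih2 ?_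
    rw [ha']; exact ih3
  | tyCtx _ ih => exact .tyCtx ih
  | tmTy _ ih => exact .tmTy ih

end Pres

/-- A (large) nonempty family of cwfs with constants. -/
structure Par : Type (u + 2) where
  J : Type (u + 1)
  ne : Nonempty J
  cw : J → CwF.{u, u, u, u}
  K : Type u
  c : (j : J) → K → Elt (cw j)
  kind : ∀ k, (∀ j, ∃ Γ A, c j k = .ty Γ A) ∨ (∀ j, ∃ Γ A a, c j k = .tm Γ A a)

namespace Par
variable (P : Par.{u})

def V (r : Raw P.K) (j : P.J) (e : Elt (P.cw j)) : Prop := Ev (P.cw j) (P.c j) r e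

def std : Setoid (Raw P.K) where
  r r s := ∀ j e, P.V r j e ↔ P.V s j e
  iseqv := ⟨fun _ _ _ => Iff.rfl, fun h j e => (h j e).symm,
    fun h h' j e => (h j e).trans (h' j e)⟩

def X : Type u := Quotient P.std

variable {P}

def X.mk (r : Raw P.K) : P.X := Quotient.mk P.std r
noncomputable def X.rep (x : P.X) : Raw P.K := Quotient.out x

def X.E (x : P.X) (j : P.J) (e : Elt (P.cw j)) : Prop := P.V x.rep j e

theorem X.E_mk (r : Raw P.K) (j : P.J) (e : Elt (P.cw j)) : (X.mk r).E j e ↔ P.V r j e :=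
  (Quotient.exact (s := P.std) (Quotient.out_eq (s := P.std) (X.mk r))) j e

theorem X.mk_rep (x : P.X) : X.mk x.rep = x := Quotient.out_eq (s := P.std) x

theorem X.fn {x : P.X} {j : P.J} {e e' : Elt (P.cw j)} (h : x.E j e) (h' : x.E j e') : e = e' :=
  Ev.fn h h'

theorem X.ext {x y : P.X} (h : ∀ j, ∃ e, x.E j e ∧ y.E j e) : x = y := by
  rw [← x.mk_rep, ← y.mk_rep]
  refine Quotient.sound (s := P.std) ?_
  intro j e
  obtain ⟨e', h1, h2⟩ := h j
  constructor
  · intro h3; cases X.fn h1 h3; exact h2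
  · intro h3; cases X.fn h2 h3; exact h1

variable (P)

def Ctx : Type u := {x : P.X // ∀ j, ∃ Γ, x.E j (.ctx Γ)}
variable {P}
noncomputable def Ctx.at (Γ : P.Ctx) (j : P.J) : (P.cw j).Ctx := (Γ.2 j).choose
theorem Ctx.spec (Γ : P.Ctx) (j : P.J) : Γ.1.E j (.ctx (Γ.at j)) := (Γ.2 j).choose_spec

def Hom (Δ Γ : P.Ctx) : Type u := {x : P.X // ∀ j, ∃ γ, x.E j (.hom (Δ.at j) (Γ.at j) γ)}
noncomputable def Hom.at {Δ Γ : P.Ctx} (γ : P.Hom Δ Γ) (j : P.J) :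
    (P.cw j).Hom (Δ.at j) (Γ.at j) := (γ.2 j).choose
theorem Hom.spec {Δ Γ : P.Ctx} (γ : P.Hom Δ Γ) (j : P.J) : γ.1.E j (.hom _ _ (γ.at j)) :=
  (γ.2 j).choose_spec

def Ty (Γ : P.Ctx) : Type u := {x : P.X // ∀ j, ∃ A, x.E j (.ty (Γ.at j) A)}
noncomputable def Ty.at {Γ : P.Ctx} (A : P.Ty Γ) (j : P.J) : (P.cw j).Ty (Γ.at j) :=
  (A.2 j).choose
theorem Ty.spec {Γ : P.Ctx} (A : P.Ty Γ) (j : P.J) : A.1.E j (.ty _ (A.at j)) :=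
  (A.2 j).choose_spec

def Tm (Γ : P.Ctx) (A : P.Ty Γ) : Type u := {x : P.X // ∀ j, ∃ a, x.E j (.tm (Γ.at j) (A.at j) a)}
noncomputable def Tm.at {Γ : P.Ctx} {A : P.Ty Γ} (a : P.Tm Γ A) (j : P.J) :
    (P.cw j).Tm (Γ.at j) (A.at j) := (a.2 j).choose
theorem Tm.spec {Γ : P.Ctx} {A : P.Ty Γ} (a : P.Tm Γ A) (j : P.J) : a.1.E j (.tm _ _ (a.at j)) :=
  (a.2 j).choose_spec

theorem Ctx.ext {Γ Γ' : P.Ctx} (h : ∀ j, Γ.at j = Γ'.at j) : Γ = Γ' :=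
  Subtype.ext (X.ext fun j => ⟨_, Γ.spec j, by rw [h]; exact Γ'.spec j⟩)

theorem Hom.ext {Δ Γ : P.Ctx} {γ γ' : P.Hom Δ Γ} (h : ∀ j, γ.at j = γ'.at j) : γ = γ' :=
  Subtype.ext (X.ext fun j => ⟨_, γ.spec j, by rw [h]; exact γ'.spec j⟩)

theorem Ty.ext {Γ : P.Ctx} {A A' : P.Ty Γ} (h : ∀ j, A.at j = A'.at j) : A = A' :=
  Subtype.ext (X.ext fun j => ⟨_, A.spec j, by rw [h]; exact A'.spec j⟩)

theorem Tm.ext {Γ : P.Ctx} {A A' : P.Ty Γ} {a : P.Tm Γ A} {a' : P.Tm Γ A'} (hA : A = A')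
    (h : ∀ j, Elt.tm _ _ (a.at j) = Elt.tm _ _ (a'.at j)) : HEq a a' := by
  subst hA
  exact heq_of_eq (Subtype.ext (X.ext fun j => ⟨_, a.spec j, by rw [h]; exact a'.spec j⟩))

theorem Tm.at_heq {Γ : P.Ctx} {A A' : P.Ty Γ} {a : P.Tm Γ A} {a' : P.Tm Γ A'} (hA : A = A')
    (h : HEq a a') (j : P.J) : Elt.tm _ _ (a.at j) = Elt.tm _ _ (a'.at j) := by
  subst hA; cases h; rfl

noncomputable def id' (Γ : P.Ctx) : P.Hom Γ Γ :=
  ⟨X.mk (.id Γ.1.rep), fun j => ⟨_, (X.E_mk _ _ _).2 (Ev.id (Γ.spec j))⟩⟩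
theorem id_at (Γ : P.Ctx) (j : P.J) : (id' Γ).at j = (P.cw j).id _ :=
  hom_inj (X.fn ((id' Γ).spec j) ((X.E_mk _ _ _).2 (Ev.id (Γ.spec j))))

noncomputable def comp' {Ξ Δ Γ : P.Ctx} (γ : P.Hom Δ Γ) (δ : P.Hom Ξ Δ) : P.Hom Ξ Γ :=
  ⟨X.mk (.comp γ.1.rep δ.1.rep),
    fun j => ⟨_, (X.E_mk _ _ _).2 (Ev.comp (γ.spec j) (δ.spec j))⟩⟩
theorem comp_at {Ξ Δ Γ : P.Ctx} (γ : P.Hom Δ Γ) (δ : P.Hom Ξ Δ) (j : P.J) :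
    (comp' γ δ).at j = (P.cw j).comp (γ.at j) (δ.at j) :=
  hom_inj (X.fn ((comp' γ δ).spec j) ((X.E_mk _ _ _).2 (Ev.comp (γ.spec j) (δ.spec j))))

noncomputable def subTy' {Δ Γ : P.Ctx} (A : P.Ty Γ) (γ : P.Hom Δ Γ) : P.Ty Δ :=
  ⟨X.mk (.subTy A.1.rep γ.1.rep),
    fun j => ⟨_, (X.E_mk _ _ _).2 (Ev.subTy (A.spec j) (γ.spec j))⟩⟩
theorem subTy_at {Δ Γ : P.Ctx} (A : P.Ty Γ) (γ : P.Hom Δ Γ) (j : P.J) :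
    (subTy' A γ).at j = (P.cw j).subTy (A.at j) (γ.at j) :=
  ty_inj (X.fn ((subTy' A γ).spec j) ((X.E_mk _ _ _).2 (Ev.subTy (A.spec j) (γ.spec j))))

theorem exE_tm {x : P.X} {j : P.J} {Γ Γ' : (P.cw j).Ctx} {A : (P.cw j).Ty Γ}
    {A' : (P.cw j).Ty Γ'} {a : (P.cw j).Tm Γ A} (h : x.E j (.tm _ _ a))
    (hA : Elt.ty _ A = Elt.ty _ A') : ∃ a', x.E j (.tm Γ' A' a') := by
  cases hA; exact ⟨_, h⟩

theorem exE_hom {x : P.X} {j : P.J} {Δ Γ Δ' Γ' : (P.cw j).Ctx} {γ : (P.cw j).Hom Δ Γ}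
    (h : x.E j (.hom _ _ γ)) (h1 : Δ = Δ') (h2 : Γ = Γ') : ∃ γ', x.E j (.hom Δ' Γ' γ') := by
  subst h1 h2; exact ⟨_, h⟩

noncomputable def subTm' {Δ Γ : P.Ctx} {A : P.Ty Γ} (a : P.Tm Γ A) (γ : P.Hom Δ Γ) :
    P.Tm Δ (subTy' A γ) :=
  ⟨X.mk (.subTm a.1.rep γ.1.rep),
    fun j => exE_tm ((X.E_mk _ _ _).2 (Ev.subTm (a.spec j) (γ.spec j)))
      (by rw [subTy_at])⟩
theorem subTm_at {Δ Γ : P.Ctx} {A : P.Ty Γ} (a : P.Tm Γ A) (γ : P.Hom Δ Γ) (j : P.J) :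
    Elt.tm _ _ ((subTm' a γ).at j) = Elt.tm _ _ ((P.cw j).subTm (a.at j) (γ.at j)) :=
  X.fn ((subTm' a γ).spec j) ((X.E_mk _ _ _).2 (Ev.subTm (a.spec j) (γ.spec j)))

variable (P) in
noncomputable def one' : P.Ctx := ⟨X.mk .one, fun _ => ⟨_, (X.E_mk _ _ _).2 Ev.one⟩⟩
theorem one_at (j : P.J) : P.one'.at j = (P.cw j).one := by
  have := X.fn (P.one'.spec j) ((X.E_mk _ _ _).2 Ev.one)
  injection this

noncomputable def bang' (Γ : P.Ctx) : P.Hom Γ P.one' :=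
  ⟨X.mk (.bang Γ.1.rep),
    fun j => exE_hom ((X.E_mk _ _ _).2 (Ev.bang (Γ.spec j))) rfl (one_at j).symm⟩

theorem bang_unique' {Γ : P.Ctx} (γ : P.Hom Γ P.one') : γ = bang' Γ := by
  have key : ∀ (j : P.J) (Θ : (P.cw j).Ctx), Θ = (P.cw j).one →
      ∀ (Δ : (P.cw j).Ctx) (a b : (P.cw j).Hom Δ Θ), a = b := by
    intro j Θ h Δ a b
    subst h
    rw [(P.cw j).bang_unique a, (P.cw j).bang_unique b]
  exact Hom.ext fun j => key j _ (one_at j) _ _ _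

noncomputable def ext' (Γ : P.Ctx) (A : P.Ty Γ) : P.Ctx :=
  ⟨X.mk (.ext A.1.rep), fun j => ⟨_, (X.E_mk _ _ _).2 (Ev.ext (A.spec j))⟩⟩
theorem ext_at (Γ : P.Ctx) (A : P.Ty Γ) (j : P.J) :
    (ext' Γ A).at j = (P.cw j).ext (Γ.at j) (A.at j) := by
  have := X.fn ((ext' Γ A).spec j) ((X.E_mk _ _ _).2 (Ev.ext (A.spec j)))
  injection this

noncomputable def p' {Γ : P.Ctx} (A : P.Ty Γ) : P.Hom (ext' Γ A) Γ :=
  ⟨X.mk (.p A.1.rep),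
    fun j => exE_hom ((X.E_mk _ _ _).2 (Ev.p (A.spec j))) (ext_at Γ A j).symm rfl⟩
theorem p_at {Γ : P.Ctx} (A : P.Ty Γ) (j : P.J) :
    Elt.hom _ _ ((p' A).at j) = Elt.hom _ _ ((P.cw j).p (A.at j)) :=
  X.fn ((p' A).spec j) ((X.E_mk _ _ _).2 (Ev.p (A.spec j)))

noncomputable def q' {Γ : P.Ctx} (A : P.Ty Γ) : P.Tm (ext' Γ A) (subTy' A (p' A)) :=
  ⟨X.mk (.q A.1.rep),
    fun j => exE_tm ((X.E_mk _ _ _).2 (Ev.q (A.spec j)))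
      (by rw [subTy_at]; exact subTy_congr rfl (p_at A j).symm)⟩
theorem q_at {Γ : P.Ctx} (A : P.Ty Γ) (j : P.J) :
    Elt.tm _ _ ((q' A).at j) = Elt.tm _ _ ((P.cw j).q (A.at j)) :=
  X.fn ((q' A).spec j) ((X.E_mk _ _ _).2 (Ev.q (A.spec j)))

theorem exists_pt {Δ Γ : P.Ctx} (A : P.Ty Γ) (γ : P.Hom Δ Γ) (a : P.Tm Δ (subTy' A γ)) (j : P.J) :
    ∃ a1 : (P.cw j).Tm (Δ.at j) ((P.cw j).subTy (A.at j) (γ.at j)),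
      Elt.tm _ _ a1 = Elt.tm _ _ (a.at j) :=
  exists_tm _ (by rw [subTy_at])

noncomputable def pair' {Δ Γ : P.Ctx} (A : P.Ty Γ) (γ : P.Hom Δ Γ) (a : P.Tm Δ (subTy' A γ)) :
    P.Hom Δ (ext' Γ A) :=
  ⟨X.mk (.pair A.1.rep γ.1.rep a.1.rep), fun j => by
    obtain ⟨a1, h⟩ := exists_pt A γ a j
    exact exE_hom ((X.E_mk _ _ _).2
      (Ev.pair (A.spec j) (γ.spec j) (by rw [h]; exact a.spec j))) rfl (ext_at Γ A j).symm⟩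
theorem pair_at {Δ Γ : P.Ctx} (A : P.Ty Γ) (γ : P.Hom Δ Γ) (a : P.Tm Δ (subTy' A γ)) (j : P.J)
    (a1 : (P.cw j).Tm (Δ.at j) ((P.cw j).subTy (A.at j) (γ.at j)))
    (h : Elt.tm _ _ a1 = Elt.tm _ _ (a.at j)) :
    Elt.hom _ _ ((pair' A γ a).at j) = Elt.hom _ _ ((P.cw j).pair (A.at j) (γ.at j) a1) :=
  X.fn ((pair' A γ a).spec j) ((X.E_mk _ _ _).2
      (Ev.pair (A.spec j) (γ.spec j) (by rw [h]; exact a.spec j)))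

theorem subTy_comp' {Ξ Δ Γ : P.Ctx} (A : P.Ty Γ) (γ : P.Hom Δ Γ) (δ : P.Hom Ξ Δ) :
    subTy' A (comp' γ δ) = subTy' (subTy' A γ) δ :=
  Ty.ext fun j => by simp only [subTy_at, comp_at, (P.cw j).subTy_comp]

theorem subTy_id' {Γ : P.Ctx} (A : P.Ty Γ) : subTy' A (id' Γ) = A :=
  Ty.ext fun j => by simp only [subTy_at, id_at, (P.cw j).subTy_id]

theorem p_pair' {Δ Γ : P.Ctx} (A : P.Ty Γ) (γ : P.Hom Δ Γ) (a : P.Tm Δ (subTy' A γ)) :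
    comp' (p' A) (pair' A γ a) = γ :=
  Hom.ext fun j => by
    obtain ⟨a1, h⟩ := exists_pt A γ a j
    apply hom_inj
    rw [comp_at, comp_congr (p_at A j) (pair_at A γ a j a1 h), (P.cw j).p_pair]

variable (P) in
noncomputable def I : CwF.{u, u, u, u} where
  Ctx := P.Ctx
  Hom := P.Hom
  id := id'
  comp := comp'
  id_comp γ := Hom.ext fun j => by rw [comp_at, id_at, (P.cw j).id_comp]
  comp_id γ := Hom.ext fun j => by rw [comp_at, id_at, (P.cw j).comp_id]
  comp_assoc γ δ ξ := Hom.ext fun j => by simp only [comp_at, (P.cw j).comp_assoc]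
  Ty := P.Ty
  Tm := P.Tm
  subTy := subTy'
  subTm := subTm'
  subTy_id := subTy_id'
  subTy_comp := subTy_comp'
  subTm_id a := Tm.ext (subTy_id' _) fun j => by
    rw [subTm_at, id_at]
    exact tm_ext rfl (heq_of_eq ((P.cw j).subTy_id _)) ((P.cw j).subTm_id _)
  subTm_comp a γ δ := Tm.ext (subTy_comp' _ _ _) fun j => by
    rw [subTm_at, comp_at, subTm_at, subTm_congr (subTm_at a γ j) rfl]
    exact tm_ext rfl (heq_of_eq ((P.cw j).subTy_comp _ _ _)) ((P.cw j).subTm_comp _ _ _)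
  one := P.one'
  bang := bang'
  bang_unique := bang_unique'
  ext := ext'
  p := p'
  q := q'
  pair := pair'
  p_pair := p_pair'
  q_pair A γ a := Tm.ext (by rw [← subTy_comp', p_pair']) fun j => by
    obtain ⟨a1, h⟩ := exists_pt A γ a j
    rw [subTm_at, subTm_congr (q_at A j) (pair_at A γ a j a1 h), ← h]
    exact tm_ext rfl (by rw [← (P.cw j).subTy_comp, (P.cw j).p_pair]) ((P.cw j).q_pair _ _ _)
  pair_unique A γ a δ h1 h2 := Hom.ext fun j => by
    obtain ⟨a1, h⟩ := exists_pt A γ a j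
    apply hom_inj
    rw [pair_at A γ a j a1 h]
    refine pair_unique' _ _ _ (ext_at _ A j) _ _ (p_at A j) _ _ (q_at A j) ?_ ?_
    · rw [← comp_at, h1]
    · rw [h, ← subTm_at]
      exact Tm.at_heq (by rw [← subTy_comp', h1]) h2 j

/-- The projections. -/
noncomputable def π (j : P.J) : CwFHom P.I (P.cw j) where
  obj Γ := Ctx.at Γ j
  map γ := Hom.at γ j
  map_id Γ := id_at Γ j
  map_comp γ δ := comp_at γ δ j
  mapTy A := Ty.at A j
  mapTm a := Tm.at a j
  mapTy_sub A γ := subTy_at A γ j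
  mapTm_sub a γ := tm_heq (subTm_at a γ j)
  obj_one := one_at j
  obj_ext A := ext_at _ A j
  map_p A := hom_heq (p_at A j)
  map_q A := tm_heq (q_at A j)

/-- Joint injectivity. -/
theorem π_inj (e e' : Elt P.I) (h : ∀ j, elt (π j) e = elt (π j) e') : e = e' := by
  obtain ⟨j0⟩ := P.ne
  have h0 := h j0
  cases e <;> cases e' <;> simp only [elt, reduceCtorEq] at h0
  · rename_i Γ Γ'
    exact congrArg _ (Ctx.ext fun j => by have := h j; injection this)
  · rename_i Δ Γ γ Δ' Γ' γ'
    have h1 : Δ = Δ' := Ctx.ext fun j => by have := h j; injection this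
    have h2 : Γ = Γ' := Ctx.ext fun j => by have := h j; injection this
    subst h1 h2
    exact congrArg _ (Hom.ext fun j => hom_inj (h j))
  · rename_i Γ A Γ' A'
    have h1 : Γ = Γ' := Ctx.ext fun j => by have := h j; injection this
    subst h1
    exact congrArg _ (Ty.ext fun j => ty_inj (h j))
  · rename_i Γ A a Γ' A' a'
    have h1 : Γ = Γ' := Ctx.ext fun j => by have := h j; injection this
    subst h1
    have h2 : A = A' := Ty.ext fun j => ty_inj (tm_ty (h j))
    subst h2
    exact congrArg _ (eq_of_heq (Tm.ext rfl h))

theorem exists_ty_of (r : Raw P.K) (h : ∀ j, ∃ Γ A, P.V r j (.ty Γ A)) :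
    ∃ e : Elt P.I, ∀ j, P.V r j (elt (π j) e) := by
  let Γ : P.Ctx := ⟨X.mk (.tyCtx r), fun j => by
    obtain ⟨Γ, A, h⟩ := h j
    exact ⟨Γ, (X.E_mk _ _ _).2 (Ev.tyCtx h)⟩⟩
  have hT : ∀ j, ∃ A, (X.mk r).E j (.ty (Γ.at j) A) := fun j => by
    obtain ⟨Γ', A, h⟩ := h j
    have : Elt.ctx (Γ.at j) = Elt.ctx Γ' :=
      X.fn (Γ.spec j) ((X.E_mk _ _ _).2 (Ev.tyCtx h))
    injection this with this
    rw [this]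
    exact ⟨A, (X.E_mk _ _ _).2 h⟩
  let A : P.Ty Γ := ⟨X.mk r, hT⟩
  exact ⟨.ty (C := P.I) Γ A, fun j => (X.E_mk _ _ _).1 (A.spec j)⟩

theorem exists_tm_of (r : Raw P.K) (h : ∀ j, ∃ Γ A a, P.V r j (.tm Γ A a)) :
    ∃ e : Elt P.I, ∀ j, P.V r j (elt (π j) e) := by
  obtain ⟨e, he⟩ := exists_ty_of (.tmTy r) (fun j => by
    obtain ⟨Γ, A, a, h⟩ := h j
    exact ⟨Γ, A, Ev.tmTy h⟩)
  have he' : ∀ j, ∃ Γ A a, P.V r j (.tm Γ A a) ∧ elt (π j) e = .ty Γ A := fun j => by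
    obtain ⟨Γ, A, a, h⟩ := h j
    exact ⟨Γ, A, a, h, Ev.fn (he j) (Ev.tmTy h)⟩
  obtain ⟨j0⟩ := P.ne
  obtain ⟨_, _, _, _, h0⟩ := he' j0
  cases e <;> simp only [elt, reduceCtorEq] at h0
  rename_i Γ A
  have hT : ∀ j, ∃ a, (X.mk r).E j (.tm (Ctx.at Γ j) (Ty.at A j) a) := fun j => by
    obtain ⟨Γ', A', a, h1, h2⟩ := he' j
    exact exE_tm ((X.E_mk _ _ _).2 h1) h2.symm
  let a : P.Tm Γ A := ⟨X.mk r, hT⟩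
  exact ⟨.tm (C := P.I) Γ A a, fun j => (X.E_mk _ _ _).1 (a.spec j)⟩

theorem exists_const (k : P.K) : ∃ e : Elt P.I, ∀ j, elt (π j) e = P.c j k := by
  have : ∃ e : Elt P.I, ∀ j, P.V (.const k) j (elt (π j) e) := by
    rcases P.kind k with h | h
    · refine exists_ty_of _ fun j => ?_
      obtain ⟨Γ, A, h⟩ := h j
      exact ⟨Γ, A, by rw [← h]; exact Ev.const k⟩
    · refine exists_tm_of _ fun j => ?_
      obtain ⟨Γ, A, a, h⟩ := h j
      exact ⟨Γ, A, a, by rw [← h]; exact Ev.const k⟩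
  obtain ⟨e, he⟩ := this
  exact ⟨e, fun j => Ev.fn (he j) (Ev.const k)⟩

variable (P) in
noncomputable def cI (k : P.K) : Elt P.I := (exists_const k).choose
theorem cI_spec (k : P.K) (j : P.J) : elt (π j) (P.cI k) = P.c j k :=
  (exists_const k).choose_spec j

theorem ev_proj {r : Raw P.K} {e : Elt P.I} (h : Ev P.I P.cI r e) (j : P.J) :
    P.V r j (elt (π j) e) := Ev.map (π j) (fun k => cI_spec k j) h

theorem of_elt_ctx {C D : CwF.{u, u, u, u}} {F : CwFHom C D} {e : Elt C} {Γ}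
    (h : elt F e = .ctx Γ) : ∃ Γ', e = .ctx Γ' := by
  cases e <;> simp only [elt, reduceCtorEq] at h
  exact ⟨_, rfl⟩
theorem of_elt_hom {C D : CwF.{u, u, u, u}} {F : CwFHom C D} {e : Elt C} {Δ Γ γ}
    (h : elt F e = .hom Δ Γ γ) : ∃ Δ' Γ' γ', e = .hom Δ' Γ' γ' := by
  cases e <;> simp only [elt, reduceCtorEq] at h
  exact ⟨_, _, _, rfl⟩
theorem of_elt_ty {C D : CwF.{u, u, u, u}} {F : CwFHom C D} {e : Elt C} {Γ A}
    (h : elt F e = .ty Γ A) : ∃ Γ' A', e = .ty Γ' A' := by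
  cases e <;> simp only [elt, reduceCtorEq] at h
  exact ⟨_, _, rfl⟩
theorem of_elt_tm {C D : CwF.{u, u, u, u}} {F : CwFHom C D} {e : Elt C} {Γ A a}
    (h : elt F e = .tm Γ A a) : ∃ Γ' A' a', e = .tm Γ' A' a' := by
  cases e <;> simp only [elt, reduceCtorEq] at h
  exact ⟨_, _, _, rfl⟩

theorem gen_ctx {r : Raw P.K} (ih : (∀ j, ∃ e, P.V r j e) → ∃ e, Ev P.I P.cI r e)
    (h : ∀ j, ∃ Γ, P.V r j (.ctx Γ)) : ∃ Γ, Ev P.I P.cI r (.ctx Γ) := by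
  obtain ⟨e, he⟩ := ih fun j => ⟨_, (h j).choose_spec⟩
  obtain ⟨j0⟩ := P.ne
  obtain ⟨Γ, h0⟩ := h j0
  obtain ⟨Γ', rfl⟩ := of_elt_ctx (Ev.fn (ev_proj he j0) h0)
  exact ⟨_, he⟩

theorem gen_hom {r : Raw P.K} (ih : (∀ j, ∃ e, P.V r j e) → ∃ e, Ev P.I P.cI r e)
    (h : ∀ j, ∃ Δ Γ γ, P.V r j (.hom Δ Γ γ)) : ∃ Δ Γ γ, Ev P.I P.cI r (.hom Δ Γ γ) := by
  obtain ⟨e, he⟩ := ih fun j => ⟨_, (h j).choose_spec.choose_spec.choose_spec⟩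
  obtain ⟨j0⟩ := P.ne
  obtain ⟨Δ, Γ, γ, h0⟩ := h j0
  obtain ⟨Δ', Γ', γ', rfl⟩ := of_elt_hom (Ev.fn (ev_proj he j0) h0)
  exact ⟨_, _, _, he⟩

theorem gen_ty {r : Raw P.K} (ih : (∀ j, ∃ e, P.V r j e) → ∃ e, Ev P.I P.cI r e)
    (h : ∀ j, ∃ Γ A, P.V r j (.ty Γ A)) : ∃ Γ A, Ev P.I P.cI r (.ty Γ A) := by
  obtain ⟨e, he⟩ := ih fun j => ⟨_, (h j).choose_spec.choose_spec⟩
  obtain ⟨j0⟩ := P.ne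
  obtain ⟨Γ, A, h0⟩ := h j0
  obtain ⟨Γ', A', rfl⟩ := of_elt_ty (Ev.fn (ev_proj he j0) h0)
  exact ⟨_, _, he⟩

theorem gen_tm {r : Raw P.K} (ih : (∀ j, ∃ e, P.V r j e) → ∃ e, Ev P.I P.cI r e)
    (h : ∀ j, ∃ Γ A a, P.V r j (.tm Γ A a)) : ∃ Γ A a, Ev P.I P.cI r (.tm Γ A a) := by
  obtain ⟨e, he⟩ := ih fun j => ⟨_, (h j).choose_spec.choose_spec.choose_spec⟩
  obtain ⟨j0⟩ := P.ne
  obtain ⟨Γ, A, a, h0⟩ := h j0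
  obtain ⟨Γ', A', a', rfl⟩ := of_elt_tm (Ev.fn (ev_proj he j0) h0)
  exact ⟨_, _, _, he⟩

theorem gen (r : Raw P.K) : (∀ j, ∃ e, P.V r j e) → ∃ e, Ev P.I P.cI r e := by
  induction r with
  | const k => exact fun _ => ⟨_, .const k⟩
  | one => exact fun _ => ⟨_, .one⟩
  | id r ih =>
    intro h
    obtain ⟨Γ, hΓ⟩ := gen_ctx ih fun j => by
      obtain ⟨e, he⟩ := h j
      cases he with | id h1 => exact ⟨_, h1⟩
    exact ⟨_, .id hΓ⟩
  | bang r ih =>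
    intro h
    obtain ⟨Γ, hΓ⟩ := gen_ctx ih fun j => by
      obtain ⟨e, he⟩ := h j
      cases he with | bang h1 => exact ⟨_, h1⟩
    exact ⟨_, .bang hΓ⟩
  | ext r ih =>
    intro h
    obtain ⟨Γ, A, hA⟩ := gen_ty ih fun j => by
      obtain ⟨e, he⟩ := h j
      cases he with | ext h1 => exact ⟨_, _, h1⟩
    exact ⟨_, .ext hA⟩
  | p r ih =>
    intro h
    obtain ⟨Γ, A, hA⟩ := gen_ty ih fun j => by
      obtain ⟨e, he⟩ := h j
      cases he with | p h1 => exact ⟨_, _, h1⟩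
    exact ⟨_, .p hA⟩
  | q r ih =>
    intro h
    obtain ⟨Γ, A, hA⟩ := gen_ty ih fun j => by
      obtain ⟨e, he⟩ := h j
      cases he with | q h1 => exact ⟨_, _, h1⟩
    exact ⟨_, .q hA⟩
  | tyCtx r ih =>
    intro h
    obtain ⟨Γ, A, hA⟩ := gen_ty ih fun j => by
      obtain ⟨e, he⟩ := h j
      cases he with | tyCtx h1 => exact ⟨_, _, h1⟩
    exact ⟨_, .tyCtx hA⟩
  | tmTy r ih =>
    intro h
    obtain ⟨Γ, A, a, hA⟩ := gen_tm ih fun j => by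
      obtain ⟨e, he⟩ := h j
      cases he with | tmTy h1 => exact ⟨_, _, _, h1⟩
    exact ⟨_, .tmTy hA⟩
  | comp r s ih1 ih2 =>
    intro h
    have h' : ∀ j, ∃ Ξ Δ Γ, ∃ γ : (P.cw j).Hom Δ Γ, ∃ δ : (P.cw j).Hom Ξ Δ,
        P.V r j (.hom _ _ γ) ∧ P.V s j (.hom _ _ δ) := fun j => by
      obtain ⟨e, he⟩ := h j
      cases he with | comp h1 h2 => exact ⟨_, _, _, _, _, h1, h2⟩
    obtain ⟨Δ, Γ, γ, hγ⟩ := gen_hom ih1 fun j => by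
      obtain ⟨_, _, _, _, _, h1, h2⟩ := h' j; exact ⟨_, _, _, h1⟩
    obtain ⟨Ξ, Δ', δ, hδ⟩ := gen_hom ih2 fun j => by
      obtain ⟨_, _, _, _, _, h1, h2⟩ := h' j; exact ⟨_, _, _, h2⟩
    have e : Δ' = Δ := Ctx.ext fun j => by
      obtain ⟨_, _, _, _, _, h1, h2⟩ := h' j
      have e1 := Ev.fn (ev_proj hγ j) h1
      have e2 := Ev.fn (ev_proj hδ j) h2
      injection e1 with e1; injection e2 with _ e2
      exact e2.trans e1.symm
    subst e
    exact ⟨_, .comp hγ hδ⟩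
  | subTy r s ih1 ih2 =>
    intro h
    have h' : ∀ j, ∃ Δ Γ, ∃ A : (P.cw j).Ty Γ, ∃ δ : (P.cw j).Hom Δ Γ,
        P.V r j (.ty _ A) ∧ P.V s j (.hom _ _ δ) := fun j => by
      obtain ⟨e, he⟩ := h j
      cases he with | subTy h1 h2 => exact ⟨_, _, _, _, h1, h2⟩
    obtain ⟨Γ, A, hA⟩ := gen_ty ih1 fun j => by
      obtain ⟨_, _, _, _, h1, h2⟩ := h' j; exact ⟨_, _, h1⟩
    obtain ⟨Δ, Γ', δ, hδ⟩ := gen_hom ih2 fun j => by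
      obtain ⟨_, _, _, _, h1, h2⟩ := h' j; exact ⟨_, _, _, h2⟩
    have e : Γ' = Γ := Ctx.ext fun j => by
      obtain ⟨_, _, _, _, h1, h2⟩ := h' j
      have e1 := Ev.fn (ev_proj hA j) h1
      have e2 := Ev.fn (ev_proj hδ j) h2
      injection e1 with e1; injection e2 with _ e2
      exact e2.trans e1.symm
    subst e
    exact ⟨_, .subTy hA hδ⟩
  | subTm r s ih1 ih2 =>
    intro h
    have h' : ∀ j, ∃ Δ Γ, ∃ A : (P.cw j).Ty Γ, ∃ a : (P.cw j).Tm Γ A, ∃ δ : (P.cw j).Hom Δ Γ,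
        P.V r j (.tm _ _ a) ∧ P.V s j (.hom _ _ δ) := fun j => by
      obtain ⟨e, he⟩ := h j
      cases he with | subTm h1 h2 => exact ⟨_, _, _, _, _, h1, h2⟩
    obtain ⟨Γ, A, a, hA⟩ := gen_tm ih1 fun j => by
      obtain ⟨_, _, _, _, _, h1, h2⟩ := h' j; exact ⟨_, _, _, h1⟩
    obtain ⟨Δ, Γ', δ, hδ⟩ := gen_hom ih2 fun j => by
      obtain ⟨_, _, _, _, _, h1, h2⟩ := h' j; exact ⟨_, _, _, h2⟩
    have e : Γ' = Γ := Ctx.ext fun j => by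
      obtain ⟨_, _, _, _, _, h1, h2⟩ := h' j
      have e1 := Ev.fn (ev_proj hA j) h1
      have e2 := Ev.fn (ev_proj hδ j) h2
      injection e1 with e1; injection e2 with _ e2
      exact e2.trans e1.symm
    subst e
    exact ⟨_, .subTm hA hδ⟩
  | pair r s t ih1 ih2 ih3 =>
    intro h
    have h' : ∀ j, ∃ Δ Γ, ∃ A : (P.cw j).Ty Γ, ∃ δ : (P.cw j).Hom Δ Γ,
        ∃ a : (P.cw j).Tm Δ ((P.cw j).subTy A δ),
        P.V r j (.ty _ A) ∧ P.V s j (.hom _ _ δ) ∧ P.V t j (.tm _ _ a) := fun j => by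
      obtain ⟨e, he⟩ := h j
      cases he with | pair h1 h2 h3 => exact ⟨_, _, _, _, _, h1, h2, h3⟩
    obtain ⟨Γ, A, hA⟩ := gen_ty ih1 fun j => by
      obtain ⟨_, _, _, _, _, h1, h2, h3⟩ := h' j; exact ⟨_, _, h1⟩
    obtain ⟨Δ, Γ', δ, hδ⟩ := gen_hom ih2 fun j => by
      obtain ⟨_, _, _, _, _, h1, h2, h3⟩ := h' j; exact ⟨_, _, _, h2⟩
    obtain ⟨Δ', T, a, ha⟩ := gen_tm ih3 fun j => by
      obtain ⟨_, _, _, _, _, h1, h2, h3⟩ := h' j; exact ⟨_, _, _, h3⟩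
    have e : Γ' = Γ := Ctx.ext fun j => by
      obtain ⟨_, _, _, _, _, h1, h2, h3⟩ := h' j
      have e1 := Ev.fn (ev_proj hA j) h1
      have e2 := Ev.fn (ev_proj hδ j) h2
      injection e1 with e1; injection e2 with _ e2
      exact e2.trans e1.symm
    subst e
    have e : Δ' = Δ := Ctx.ext fun j => by
      obtain ⟨_, _, _, _, _, h1, h2, h3⟩ := h' j
      have e1 := Ev.fn (ev_proj hδ j) h2
      have e2 := Ev.fn (ev_proj ha j) h3
      injection e1 with e1; injection e2 with e2
      exact e2.trans e1.symm
    subst e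
    have e : T = subTy' A δ := Ty.ext fun j => by
      obtain ⟨_, _, _, _, _, h1, h2, h3⟩ := h' j
      have e1 := Ev.fn (ev_proj hA j) h1
      have e2 := Ev.fn (ev_proj hδ j) h2
      have e3 := Ev.fn (ev_proj ha j) h3
      refine Eq.trans ?_ (subTy_at A δ j).symm
      exact ty_inj ((tm_ty e3).trans (subTy_congr e1 e2).symm)
    subst e
    exact ⟨_, .pair hA hδ ha⟩

theorem gen_all (e : Elt P.I) : ∃ r, Ev P.I P.cI r e := by
  have key : ∃ r, ∀ j, P.V r j (elt (π j) e) := by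
    cases e with
    | ctx Γ => exact ⟨_, fun j => Ctx.spec Γ j⟩
    | hom Δ Γ γ => exact ⟨_, fun j => Hom.spec γ j⟩
    | ty Γ A => exact ⟨_, fun j => Ty.spec A j⟩
    | tm Γ A a => exact ⟨_, fun j => Tm.spec a j⟩
  obtain ⟨r, hr⟩ := key
  obtain ⟨e', he'⟩ := gen r fun j => ⟨_, hr j⟩
  have : e' = e := π_inj _ _ fun j => Ev.fn (ev_proj he' j) (hr j)
  exact ⟨r, this ▸ he'⟩

theorem hom_unique {D : CwF.{u, u, u, u}} {d : P.K → Elt D} (F G : CwFHom P.I D)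
    (hF : ∀ k, elt F (P.cI k) = d k) (hG : ∀ k, elt G (P.cI k) = d k) : F = G :=
  cwfHom_ext F G fun e => by
    obtain ⟨r, hr⟩ := gen_all e
    exact Ev.fn (hr.map F hF) (hr.map G hG)

end Par

/-- The invariant carried through the construction of signatures. -/
structure Pres (S : SigCat.{u}) where
  K : Type u
  c : (C : S.Obj) → K → Elt (S.cwf C)
  kind : ∀ k, (∀ j, ∃ Γ A, c j k = .ty Γ A) ∨ (∀ j, ∃ Γ A a, c j k = .tm Γ A a)
  mor : ∀ C D F, S.Mor C D F ↔ ∀ k, elt F (c C k) = c D k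
  triv : ∃ C : S.Obj, (∀ Γ, Nonempty ((S.cwf C).Ty Γ)) ∧
    (∀ Γ A, Nonempty ((S.cwf C).Tm Γ A)) ∧ ∀ Γ A, Subsingleton ((S.cwf C).Tm Γ A)
  create : ∀ (I : CwF.{u, u, u, u}) (cI : K → Elt I) (J : Type (u + 1)) (_ : Nonempty J)
    (D : J → S.Obj) (F : (j : J) → CwFHom I (S.cwf (D j))),
    (∀ j k, elt (F j) (cI k) = c (D j) k) →
    (∀ e e' : Elt I, (∀ j, elt (F j) e = elt (F j) e') → e = e') →
    ∃ I0 : S.Obj, S.cwf I0 = I ∧ ∀ k, HEq (c I0 k) (cI k)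

theorem Pres.initial {S : SigCat.{u}} (H : Pres S) : ∃ I : S.Obj, S.IsInitial I := by
  let P : Par.{u} := ⟨S.Obj, ⟨H.triv.choose⟩, S.cwf, H.K, H.c, H.kind⟩
  obtain ⟨I0, h1, h2⟩ := H.create P.I P.cI S.Obj P.ne (fun C => C) (fun C => Par.π (P := P) C)
    (fun j k => Par.cI_spec (P := P) k j) (Par.π_inj (P := P))
  have key : ∀ C : S.Obj, ∃! F : CwFHom P.I (S.cwf C), ∀ k, elt F (P.cI k) = H.c C k :=
    fun C => ⟨Par.π (P := P) C, fun k => Par.cI_spec (P := P) k C,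
      fun G hG => Par.hom_unique (P := P) G _ hG fun k => Par.cI_spec (P := P) k C⟩
  have hk : ∀ (I : CwF.{u, u, u, u}) (cI : H.K → Elt I), S.cwf I0 = I →
      (∀ k, HEq (H.c I0 k) (cI k)) →
      (∀ C : S.Obj, ∃! F : CwFHom I (S.cwf C), ∀ k, elt F (cI k) = H.c C k) → S.IsInitial I0 := by
    intro I cI h1 h2 h3
    subst h1
    intro C
    obtain ⟨F, hF, hu⟩ := h3 C
    have e : ∀ k, H.c I0 k = cI k := fun k => eq_of_heq (h2 k)
    refine ⟨F, (H.mor _ _ _).2 fun k => by rw [e]; exact hF k, fun G hG => hu G fun k => ?_⟩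
    rw [← e]
    exact (H.mor _ _ _).1 hG k
  exact ⟨I0, hk P.I P.cI h1 h2 key⟩

def trivCwF : CwF.{u, u, u, u} where
  Ctx := PUnit
  Hom _ _ := PUnit
  id _ := ⟨⟩
  comp _ _ := ⟨⟩
  id_comp _ := rfl
  comp_id _ := rfl
  comp_assoc _ _ _ := rfl
  Ty _ := PUnit
  Tm _ _ := PUnit
  subTy _ _ := ⟨⟩
  subTm _ _ := ⟨⟩
  subTy_id _ := rfl
  subTy_comp _ _ _ := rfl
  subTm_id _ := HEq.rfl
  subTm_comp _ _ _ := HEq.rfl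
  one := ⟨⟩
  bang _ := ⟨⟩
  bang_unique _ := rfl
  ext _ _ := ⟨⟩
  p _ := ⟨⟩
  q _ := ⟨⟩
  pair _ _ _ := ⟨⟩
  p_pair _ _ _ := rfl
  q_pair _ _ _ := HEq.rfl
  pair_unique _ _ _ _ _ _ := rfl

def presEmpty : Pres SigCat.empty.{u} where
  K := PEmpty
  c _ k := k.elim
  kind k := k.elim
  mor _ _ _ := ⟨fun _ k => k.elim, fun _ => trivial⟩
  triv := ⟨trivCwF, fun _ => ⟨PUnit.unit⟩, fun _ _ => ⟨PUnit.unit⟩,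
    fun _ _ => inferInstanceAs (Subsingleton PUnit)⟩
  create I _ _ _ _ _ _ _ := ⟨I, rfl, fun k => k.elim⟩

def presSort {S : SigCat.{u}} (H : Pres S) (Γ : UnifCtx S) : Pres (S.addSort Γ) where
  K := Option H.K
  c C k := match k with
    | none => Elt.ty (C := S.cwf C.1) _ C.2
    | some k => H.c C.1 k
  kind k := match k with
    | none => Or.inl fun C => ⟨_, _, rfl⟩
    | some k => (H.kind k).imp (fun h C => h C.1) (fun h C => h C.1)
  mor C D F := by
    constructor
    · rintro ⟨h1, h2⟩ k
      cases k with
      | none => exact ty_ext (Γ.uniform F h1) h2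
      | some k => exact (H.mor _ _ _).1 h1 k
    · intro h
      exact ⟨(H.mor _ _ _).2 fun k => h (some k), ty_heq (h none)⟩
  triv := by
    obtain ⟨C, h1, h2, h3⟩ := H.triv
    exact ⟨⟨C, (h1 _).some⟩, h1, h2, h3⟩
  create I cI J hJ D F hF hi := by
    obtain ⟨I0, h1, h2⟩ := H.create I (fun k => cI (some k)) J hJ (fun j => (D j).1) F
      (fun j k => hF j (some k)) hi
    subst h1
    have hm : ∀ j, S.Mor I0 (D j).1 (F j) := fun j => (H.mor _ _ _).2 fun k => by
      rw [eq_of_heq (h2 k)]; exact hF j (some k)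
    have hn : ∀ j, elt (F j) (cI none) = Elt.ty (C := S.cwf (D j).1) _ (D j).2 :=
      fun j => hF j none
    obtain ⟨Γ', A, hA⟩ := Par.of_elt_ty (hn hJ.some)
    have e : Elt.ctx Γ' = Elt.ctx (Γ.fam I0) := hi _ _ fun j => by
      have h3 := hn j
      rw [hA] at h3
      injection h3 with h3
      exact congrArg Elt.ctx (h3.trans (Γ.uniform (F j) (hm j)).symm)
    injection e with e
    subst e
    exact ⟨⟨I0, A⟩, rfl, fun k => match k with
      | none => heq_of_eq hA.symm
      | some k => h2 k⟩

def presOp {S : SigCat.{u}} (H : Pres S) (Γ : UnifCtx S) (A : UnifTy S Γ) :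
    Pres (S.addOp Γ A) where
  K := Option H.K
  c C k := match k with
    | none => Elt.tm (C := S.cwf C.1) _ _ C.2
    | some k => H.c C.1 k
  kind k := match k with
    | none => Or.inr fun C => ⟨_, _, _, rfl⟩
    | some k => (H.kind k).imp (fun h C => h C.1) (fun h C => h C.1)
  mor C D F := by
    constructor
    · rintro ⟨h1, h2⟩ k
      cases k with
      | none => exact tm_ext (Γ.uniform F h1) (A.uniform F h1) h2
      | some k => exact (H.mor _ _ _).1 h1 k
    · intro h
      exact ⟨(H.mor _ _ _).2 fun k => h (some k), tm_heq (h none)⟩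
  triv := by
    obtain ⟨C, h1, h2, h3⟩ := H.triv
    exact ⟨⟨C, (h2 _ _).some⟩, h1, h2, h3⟩
  create I cI J hJ D F hF hi := by
    obtain ⟨I0, h1, h2⟩ := H.create I (fun k => cI (some k)) J hJ (fun j => (D j).1) F
      (fun j k => hF j (some k)) hi
    subst h1
    have hm : ∀ j, S.Mor I0 (D j).1 (F j) := fun j => (H.mor _ _ _).2 fun k => by
      rw [eq_of_heq (h2 k)]; exact hF j (some k)
    have hn : ∀ j, elt (F j) (cI none) = Elt.tm (C := S.cwf (D j).1) _ _ (D j).2 :=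
      fun j => hF j none
    obtain ⟨Γ', T, a, ha⟩ := Par.of_elt_tm (hn hJ.some)
    have e : Elt.ty Γ' T = Elt.ty (Γ.fam I0) (A.fam I0) := hi _ _ fun j => by
      have h3 := hn j
      rw [ha] at h3
      exact (tm_ty h3).trans (ty_ext (Γ.uniform (F j) (hm j)) (A.uniform (F j) (hm j))).symm
    obtain ⟨a', ha'⟩ := exists_tm a e
    exact ⟨⟨I0, a'⟩, rfl, fun k => match k with
      | none => heq_of_eq (ha'.trans ha.symm)
      | some k => h2 k⟩

def presEq {S : SigCat.{u}} (H : Pres S) (Γ : UnifCtx S) (A : UnifTy S Γ) (a a' : UnifTm S Γ A) :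
    Pres (S.addEq Γ A a a') where
  K := H.K
  c C k := H.c C.1 k
  kind k := (H.kind k).imp (fun h C => h C.1) (fun h C => h C.1)
  mor C D F := H.mor C.1 D.1 F
  triv := by
    obtain ⟨C, h1, h2, h3⟩ := H.triv
    exact ⟨⟨C, (h3 _ _).elim _ _⟩, h1, h2, h3⟩
  create I cI J hJ D F hF hi := by
    obtain ⟨I0, h1, h2⟩ := H.create I cI J hJ (fun j => (D j).1) F hF hi
    subst h1
    have hm : ∀ j, S.Mor I0 (D j).1 (F j) := fun j => (H.mor _ _ _).2 fun k => by
      rw [eq_of_heq (h2 k)]; exact hF j k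
    have e : Elt.tm _ _ (a.fam I0) = Elt.tm _ _ (a'.fam I0) := hi _ _ fun j => by
      have h3 : ∀ b : UnifTm S Γ A, elt (F j) (.tm _ _ (b.fam I0)) = .tm _ _ (b.fam (D j).1) :=
        fun b => tm_ext (Γ.uniform _ (hm j)) (A.uniform _ (hm j)) (b.uniform _ (hm j))
      rw [h3, h3, (D j).2]
    exact ⟨⟨I0, eq_of_heq (tm_heq e)⟩, rfl, h2⟩

theorem pres_of_valid {S : SigCat.{u}} (h : S.Valid) : Nonempty (Pres S) := by
  induction h with
  | empty => exact ⟨presEmpty⟩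
  | addSort S Γ _ ih => exact ⟨presSort ih.some Γ⟩
  | addOp S Γ A _ ih => exact ⟨presOp ih.some Γ A⟩
  | addEq S Γ A a a' _ ih => exact ⟨presEq ih.some Γ A a a'⟩

end SigInit

/-- For every valid signature `Σ`, the category `CwF_Σ` of cwfs with a
`Σ`-structure and structure-preserving strict cwf-morphisms has an initial
object `T_Σ`. -/
theorem sigCat_has_initial (S : SigCat.{u}) (hS : S.Valid) :
    ∃ I : S.Obj, S.IsInitial I := by
  obtain ⟨H⟩ := SigInit.pres_of_valid hS
  exact H.initial
end

section
/- If C is an initial object of the category CwF of small cwfs and strict cwf-morphisms, then C is trivial: the underlying category of C has exactly one object (its terminal object 1), and Ty_C(Γ) is empty for every object Γ of C. -/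
universe u v w x u' v' w' x'

/-- The codiscrete category on two objects, as a cwf without types. -/
def twoCwF : CwF.{u, u, u, u} where
  Ctx := ULift.{u} Prop
  Hom _ _ := PUnit
  id _ := PUnit.unit
  comp _ _ := PUnit.unit
  id_comp _ := rfl
  comp_id _ := rfl
  comp_assoc _ _ _ := rfl
  Ty _ := PEmpty
  Tm _ _ := PEmpty
  subTy A _ := A
  subTm a _ := a
  subTy_id A := A.elim
  subTy_comp A := A.elim
  subTm_id a := a.elim
  subTm_comp a := a.elim
  one := ⟨True⟩
  bang _ := PUnit.unit
  bang_unique _ := rfl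
  ext _ A := A.elim
  p A := A.elim
  q A := A.elim
  pair A := A.elim
  p_pair A := A.elim
  q_pair A := A.elim
  pair_unique A := A.elim

/-- A cwf without types maps to `twoCwF` by any function on objects preserving `1`. -/
def toTwo (I : CwF.{u, u, u, u}) (h : ∀ Γ : I.Ctx, I.Ty Γ → False)
    (f : I.Ctx → Prop) (hf : f I.one) : CwFHom I twoCwF.{u} where
  obj Γ := ⟨f Γ⟩
  map _ := PUnit.unit
  map_id _ := rfl
  map_comp _ _ := rfl
  mapTy A := (h _ A).elim
  mapTm {_ A} _ := (h _ A).elim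
  mapTy_sub A := (h _ A).elim
  mapTm_sub {_ _ A} _ := (h _ A).elim
  obj_one := congrArg ULift.up (eq_true hf)
  obj_ext A := (h _ A).elim
  map_p A := (h _ A).elim
  map_q A := (h _ A).elim

/-- An initial object of the category `CwF` of small cwfs and strict
cwf-morphisms is trivial: its only object is its terminal object `1`, and it
has no types at all. -/
theorem initial_cwf_trivial (I : CwF.{u, u, u, u})
    (hI : ∀ C : CwF.{u, u, u, u}, ∃! _F : CwFHom I C, True) :
    (∀ Γ : I.Ctx, Γ = I.one) ∧ (∀ Γ : I.Ctx, IsEmpty (I.Ty Γ)) := by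
  have h : ∀ Γ : I.Ctx, I.Ty Γ → False := by
    intro Γ A
    obtain ⟨F, -, -⟩ := hI twoCwF
    exact PEmpty.elim (F.mapTy A)
  refine ⟨fun Γ => ?_, fun Γ => ⟨h Γ⟩⟩
  have e : toTwo I h (fun Γ => Γ = I.one) rfl = toTwo I h (fun _ => True) trivial :=
    (hI twoCwF).unique trivial trivial
  have e2 := congrFun (congrArg CwFHom.obj e) Γ
  have e3 : (Γ = I.one) = True := congrArg ULift.down e2
  exact of_eq_true e3
end

section
/- (Sort-extension step of the initiality theorem.) Let Σ be a valid signature such that CwF_Σ has an initial object, and let Γ be a uniform family of contexts over CwF_Σ. Then the category CwF_{Σ'} for the extended signature Σ' = (Σ,(Γ,S)) — whose objects are pairs (C,S_C) with C an object of CwF_Σ and S_C ∈ Ty_C(Γ_C), and whose morphisms are those F of CwF_Σ with F(S_C) = S_D — has an initial object. -/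
universe u v w x u' v' w' x'

namespace CwFree

/-! ### Congruence lemmas for cwfs -/

theorem comp_congr (P : CwF.{u, v, w, x}) {Ξ Δ Γ Ξ' Δ' Γ' : P.Ctx} (h1 : Ξ = Ξ') (h2 : Δ = Δ')
    (h3 : Γ = Γ') {γ : P.Hom Δ Γ} {γ' : P.Hom Δ' Γ'} (h4 : HEq γ γ')
    {δ : P.Hom Ξ Δ} {δ' : P.Hom Ξ' Δ'} (h5 : HEq δ δ') :
    HEq (P.comp γ δ) (P.comp γ' δ') := by
  subst h1 h2 h3; cases h4; cases h5; rfl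

theorem subTy_congr (P : CwF.{u, v, w, x}) {Δ Γ Δ' Γ' : P.Ctx} (h2 : Δ = Δ')
    (h3 : Γ = Γ') {A : P.Ty Γ} {A' : P.Ty Γ'} (hA : HEq A A')
    {γ : P.Hom Δ Γ} {γ' : P.Hom Δ' Γ'} (h4 : HEq γ γ') :
    HEq (P.subTy A γ) (P.subTy A' γ') := by
  subst h2 h3; cases h4; cases hA; rfl

theorem subTm_congr (P : CwF.{u, v, w, x}) {Δ Γ Δ' Γ' : P.Ctx} (h2 : Δ = Δ')
    (h3 : Γ = Γ') {A : P.Ty Γ} {A' : P.Ty Γ'} (hA : HEq A A')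
    {a : P.Tm Γ A} {a' : P.Tm Γ' A'} (ha : HEq a a')
    {γ : P.Hom Δ Γ} {γ' : P.Hom Δ' Γ'} (h4 : HEq γ γ') :
    HEq (P.subTm a γ) (P.subTm a' γ') := by
  subst h2 h3; cases h4; cases hA; cases ha; rfl

theorem pair_congr (P : CwF.{u, v, w, x}) {Δ Γ Δ' Γ' : P.Ctx} (h2 : Δ = Δ')
    (h3 : Γ = Γ') {A : P.Ty Γ} {A' : P.Ty Γ'} (hA : HEq A A')
    {γ : P.Hom Δ Γ} {γ' : P.Hom Δ' Γ'} (h4 : HEq γ γ')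
    {a : P.Tm Δ (P.subTy A γ)} {a' : P.Tm Δ' (P.subTy A' γ')} (ha : HEq a a') :
    HEq (P.pair A γ a) (P.pair A' γ' a') := by
  subst h2 h3; cases h4; cases hA; cases ha; rfl

theorem bang_congr (P : CwF.{u, v, w, x}) {Δ Δ' : P.Ctx} (h2 : Δ = Δ') :
    HEq (P.bang Δ) (P.bang Δ') := by
  subst h2; rfl

theorem id_congr (P : CwF.{u, v, w, x}) {Δ Δ' : P.Ctx} (h2 : Δ = Δ') :
    HEq (P.id Δ) (P.id Δ') := by
  subst h2; rfl

theorem ext_congr (P : CwF.{u, v, w, x}) {Γ Γ' : P.Ctx}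
    (h3 : Γ = Γ') {A : P.Ty Γ} {A' : P.Ty Γ'} (hA : HEq A A') :
    P.ext Γ A = P.ext Γ' A' := by
  subst h3; cases hA; rfl

theorem p_congr (P : CwF.{u, v, w, x}) {Γ Γ' : P.Ctx}
    (h3 : Γ = Γ') {A : P.Ty Γ} {A' : P.Ty Γ'} (hA : HEq A A') :
    HEq (P.p A) (P.p A') := by
  subst h3; cases hA; rfl

theorem q_congr (P : CwF.{u, v, w, x}) {Γ Γ' : P.Ctx}
    (h3 : Γ = Γ') {A : P.Ty Γ} {A' : P.Ty Γ'} (hA : HEq A A') :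
    HEq (P.q A) (P.q A') := by
  subst h3; cases hA; rfl

/-- Heterogeneous version of uniqueness of maps to the terminal object. -/
theorem bang_heq (P : CwF.{u, v, w, x}) {Δ Γ : P.Ctx} (h : Γ = P.one) (γ : P.Hom Δ Γ) :
    HEq γ (P.bang Δ) := by
  subst h; exact heq_of_eq (P.bang_unique γ)

/-- Heterogeneous version of uniqueness of pairing. -/
theorem pair_heq (P : CwF.{u, v, w, x}) {Δ Γ E : P.Ctx} (A : P.Ty Γ) (γ : P.Hom Δ Γ)
    (a : P.Tm Δ (P.subTy A γ)) (hE : E = P.ext Γ A) (p : P.Hom E Γ) (hp : HEq p (P.p A))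
    (B : P.Ty E) (q : P.Tm E B) (hB : HEq B (P.subTy A (P.p A))) (hq : HEq q (P.q A))
    (δ : P.Hom Δ E) (h1 : P.comp p δ = γ)
    (h2 : HEq (P.subTm q δ) a) : HEq δ (P.pair A γ a) := by
  subst hE; cases hp; cases hB; cases hq
  exact heq_of_eq (P.pair_unique A γ a δ h1 h2)

/-! ### Morphisms of cwfs -/

theorem hom_ext {C : CwF.{u, v, w, x}} {D : CwF.{u', v', w', x'}} {F G : CwFHom C D}
    (h1 : ∀ X, F.obj X = G.obj X)
    (h2 : ∀ {X Y} (f : C.Hom X Y), HEq (F.map f) (G.map f))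
    (h3 : ∀ {X} (A : C.Ty X), HEq (F.mapTy A) (G.mapTy A))
    (h4 : ∀ {X} {A : C.Ty X} (a : C.Tm X A), HEq (F.mapTm a) (G.mapTm a)) : F = G := by
  obtain ⟨o, m, _, _, t, k, _, _, _, _, _, _⟩ := F
  obtain ⟨o', m', _, _, t', k', _, _, _, _, _, _⟩ := G
  obtain rfl : o = o' := funext h1
  obtain rfl : @m = @m' := by
    funext X Y f; exact eq_of_heq (h2 f)
  obtain rfl : @t = @t' := by
    funext X A; exact eq_of_heq (h3 A)
  obtain rfl : @k = @k' := by
    funext X A a; exact eq_of_heq (h4 a)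
  rfl

theorem map_congr {C : CwF.{u, v, w, x}} {D : CwF.{u', v', w', x'}} (F : CwFHom C D)
    {X Y X' Y' : C.Ctx} (h1 : X = X') (h2 : Y = Y') {f : C.Hom X Y} {f' : C.Hom X' Y'}
    (h : HEq f f') : HEq (F.map f) (F.map f') := by
  subst h1 h2; cases h; rfl

theorem mapTy_congr {C : CwF.{u, v, w, x}} {D : CwF.{u', v', w', x'}} (F : CwFHom C D)
    {X X' : C.Ctx} (h1 : X = X') {A : C.Ty X} {A' : C.Ty X'}
    (h : HEq A A') : HEq (F.mapTy A) (F.mapTy A') := by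
  subst h1; cases h; rfl

theorem mapTm_congr {C : CwF.{u, v, w, x}} {D : CwF.{u', v', w', x'}} (F : CwFHom C D)
    {X X' : C.Ctx} (h1 : X = X') {A : C.Ty X} {A' : C.Ty X'}
    (h : HEq A A') {a : C.Tm X A} {a' : C.Tm X' A'} (ha : HEq a a') :
    HEq (F.mapTm a) (F.mapTm a') := by
  subst h1; cases h; cases ha; rfl

universe u₁ v₁ w₁ x₁

/-- Composition of strict cwf-morphisms. -/
def homComp {C : CwF.{u, v, w, x}} {D : CwF.{u', v', w', x'}} {E : CwF.{u₁, v₁, w₁, x₁}}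
    (G : CwFHom D E) (F : CwFHom C D) : CwFHom C E where
  obj X := G.obj (F.obj X)
  map f := G.map (F.map f)
  map_id X := by rw [F.map_id, G.map_id]
  map_comp f g := by rw [F.map_comp, G.map_comp]
  mapTy A := G.mapTy (F.mapTy A)
  mapTm a := G.mapTm (F.mapTm a)
  mapTy_sub A γ := by rw [F.mapTy_sub, G.mapTy_sub]
  mapTm_sub a γ := (mapTm_congr G rfl (heq_of_eq (F.mapTy_sub _ _)) (F.mapTm_sub a γ)).trans
    (G.mapTm_sub _ _)
  obj_one := by rw [F.obj_one, G.obj_one]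
  obj_ext A := by rw [F.obj_ext, G.obj_ext]
  map_p A := (map_congr G (F.obj_ext A) rfl (F.map_p A)).trans (G.map_p _)
  map_q A := (mapTm_congr G (F.obj_ext A)
    ((heq_of_eq (F.mapTy_sub _ _)).trans (subTy_congr D (F.obj_ext A) rfl HEq.rfl (F.map_p A)))
    (F.map_q A)).trans (G.map_q _)

theorem map_pair {C : CwF.{u, v, w, x}} {D : CwF.{u', v', w', x'}} (F : CwFHom C D)
    {Δ Γ : C.Ctx} (A : C.Ty Γ) (γ : C.Hom Δ Γ) (a : C.Tm Δ (C.subTy A γ))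
    (a' : D.Tm (F.obj Δ) (D.subTy (F.mapTy A) (F.map γ))) (ha : HEq (F.mapTm a) a') :
    HEq (F.map (C.pair A γ a)) (D.pair (F.mapTy A) (F.map γ) a') := by
  refine pair_heq D _ _ _ (F.obj_ext A) (F.map (C.p A)) (F.map_p A) _ (F.mapTm (C.q A))
    ((heq_of_eq (F.mapTy_sub _ _)).trans (subTy_congr D (F.obj_ext A) rfl HEq.rfl (F.map_p A)))
    (F.map_q A) _ ?_ ?_
  · rw [← F.map_comp, C.p_pair]
  · refine (F.mapTm_sub _ _).symm.trans (HEq.trans ?_ ha)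
    refine mapTm_congr F rfl ?_ (C.q_pair A γ a)
    rw [← C.subTy_comp, C.p_pair]

theorem map_bang {C : CwF.{u, v, w, x}} {D : CwF.{u', v', w', x'}} (F : CwFHom C D)
    (Δ : C.Ctx) : HEq (F.map (C.bang Δ)) (D.bang (F.obj Δ)) :=
  bang_heq D F.obj_one _

/-! ### Products of cwfs -/

universe t

theorem heq_apply {ι : Type t} {β β' : ι → Type u} (h : β = β') {f : ∀ i, β i} {g : ∀ i, β' i}
    (hfg : HEq f g) (i : ι) : HEq (f i) (g i) := by
  subst h; cases hfg; rfl

theorem pi_heq {ι : Type t} {β β' : ι → Type u} {f : ∀ i, β i} {g : ∀ i, β' i}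
    (h : ∀ i, HEq (f i) (g i)) : HEq f g :=
  Function.hfunext rfl (fun i j e => by cases e; exact h i)

/-- The product of a family of cwfs. -/
def prod {ι : Type t} (D : ι → CwF.{u, u, u, u}) :
    CwF.{max t u, max t u, max t u, max t u} where
  Ctx := ∀ i, (D i).Ctx
  Hom X Y := ∀ i, (D i).Hom (X i) (Y i)
  id X i := (D i).id (X i)
  comp f g i := (D i).comp (f i) (g i)
  id_comp f := funext fun i => (D i).id_comp _
  comp_id f := funext fun i => (D i).comp_id _
  comp_assoc f g h := funext fun i => (D i).comp_assoc _ _ _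
  Ty X := ∀ i, (D i).Ty (X i)
  Tm X A := ∀ i, (D i).Tm (X i) (A i)
  subTy A f i := (D i).subTy (A i) (f i)
  subTm a f i := (D i).subTm (a i) (f i)
  subTy_id A := funext fun i => (D i).subTy_id _
  subTy_comp A f g := funext fun i => (D i).subTy_comp _ _ _
  subTm_id a := pi_heq fun i => (D i).subTm_id _
  subTm_comp a f g := pi_heq fun i => (D i).subTm_comp _ _ _
  one i := (D i).one
  bang X i := (D i).bang (X i)
  bang_unique f := funext fun i => (D i).bang_unique _
  ext X A i := (D i).ext (X i) (A i)
  p A i := (D i).p (A i)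
  q A i := (D i).q (A i)
  pair A f a i := (D i).pair (A i) (f i) (a i)
  p_pair A f a := funext fun i => (D i).p_pair _ _ _
  q_pair A f a := pi_heq fun i => (D i).q_pair _ _ _
  pair_unique A f a d h1 h2 := by
    subst h1
    funext i
    refine (D i).pair_unique _ _ _ _ rfl ?_
    refine heq_apply (f := fun i => (D i).subTm ((D i).q (A i)) (d i)) ?_ h2 i
    funext i
    exact congrArg _ ((D i).subTy_comp _ _ _).symm

/-- Projections from a product. -/
def proj {ι : Type t} (D : ι → CwF.{u, u, u, u}) (i : ι) : CwFHom (prod D) (D i) where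
  obj X := X i
  map f := f i
  map_id _ := rfl
  map_comp _ _ := rfl
  mapTy A := A i
  mapTm a := a i
  mapTy_sub _ _ := rfl
  mapTm_sub _ _ := HEq.rfl
  obj_one := rfl
  obj_ext _ := rfl
  map_p _ := HEq.rfl
  map_q _ := HEq.rfl

/-- Tupling into a product. -/
def tuple {ι : Type t} (D : ι → CwF.{u, u, u, u}) {I : CwF.{u', v', w', x'}}
    (G : ∀ i, CwFHom I (D i)) : CwFHom I (prod D) where
  obj X i := (G i).obj X
  map f i := (G i).map f
  map_id _ := funext fun i => (G i).map_id _
  map_comp _ _ := funext fun i => (G i).map_comp _ _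
  mapTy A i := (G i).mapTy A
  mapTm a i := (G i).mapTm a
  mapTy_sub _ _ := funext fun i => (G i).mapTy_sub _ _
  mapTm_sub _ _ := pi_heq fun i => (G i).mapTm_sub _ _
  obj_one := funext fun i => (G i).obj_one
  obj_ext _ := funext fun i => (G i).obj_ext _
  map_p _ := pi_heq fun i => (G i).map_p _
  map_q _ := pi_heq fun i => (G i).map_q _

/-! ### Total space of elements, small sub-cwfs -/

/-- All elements (contexts, substitutions, types, terms) of a cwf. -/
inductive V (P : CwF.{u, v, w, x}) : Type (max u v w x)
  | ctx (Γ : P.Ctx) : V P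
  | hom {Δ Γ : P.Ctx} (h : P.Hom Δ Γ) : V P
  | ty {Γ : P.Ctx} (A : P.Ty Γ) : V P
  | tm {Γ : P.Ctx} {A : P.Ty Γ} (a : P.Tm Γ A) : V P

/-- A small collection of elements of a cwf closed under the operations. -/
structure Sub (P : CwF.{v, v, v, v}) where
  K : V P → Prop
  small : Small.{u} {v // K v}
  id : ∀ {Γ : P.Ctx}, K (.ctx Γ) → K (.hom (P.id Γ))
  comp : ∀ {Ξ Δ Γ : P.Ctx} {γ : P.Hom Δ Γ} {δ : P.Hom Ξ Δ}, K (.hom γ) → K (.hom δ) →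
    K (.hom (P.comp γ δ))
  subTy : ∀ {Δ Γ : P.Ctx} {A : P.Ty Γ} {γ : P.Hom Δ Γ}, K (.ty A) → K (.hom γ) →
    K (.ty (P.subTy A γ))
  subTm : ∀ {Δ Γ : P.Ctx} {A : P.Ty Γ} {a : P.Tm Γ A} {γ : P.Hom Δ Γ}, K (.tm a) → K (.hom γ) →
    K (.tm (P.subTm a γ))
  one : K (.ctx P.one)
  bang : ∀ {Γ : P.Ctx}, K (.ctx Γ) → K (.hom (P.bang Γ))
  ext : ∀ {Γ : P.Ctx} {A : P.Ty Γ}, K (.ty A) → K (.ctx (P.ext Γ A))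
  p : ∀ {Γ : P.Ctx} {A : P.Ty Γ}, K (.ty A) → K (.hom (P.p A))
  q : ∀ {Γ : P.Ctx} {A : P.Ty Γ}, K (.ty A) → K (.tm (P.q A))
  pair : ∀ {Δ Γ : P.Ctx} {A : P.Ty Γ} {γ : P.Hom Δ Γ} {a : P.Tm Δ (P.subTy A γ)},
    K (.ty A) → K (.hom γ) → K (.tm a) → K (.hom (P.pair A γ a))

namespace Sub

variable {P : CwF.{v, v, v, v}} (s : Sub.{u, v} P)

theorem small_of {α : Type v} (f : α → V P) (hf : Function.Injective f) :
    Small.{u} {a // s.K (f a)} := by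
  have := s.small
  refine small_of_injective (β := {v // s.K v}) (f := fun a => ⟨f a.1, a.2⟩) ?_
  intro a b h
  exact Subtype.ext (hf (congrArg Subtype.val h))

instance : Small.{u} {X : P.Ctx // s.K (.ctx X)} :=
  s.small_of V.ctx (fun a b h => by cases h; rfl)

instance {X Y : P.Ctx} : Small.{u} {h : P.Hom X Y // s.K (.hom h)} :=
  s.small_of V.hom (fun a b h => by cases h; rfl)

instance {X : P.Ctx} : Small.{u} {A : P.Ty X // s.K (.ty A)} :=
  s.small_of V.ty (fun a b h => by cases h; rfl)

instance {X : P.Ctx} {A : P.Ty X} : Small.{u} {a : P.Tm X A // s.K (.tm a)} :=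
  s.small_of V.tm (fun a b h => by cases h; rfl)

def Ctx' : Type u := Shrink.{u} {X : P.Ctx // s.K (.ctx X)}

noncomputable def evC (Γ : s.Ctx') : P.Ctx := ((equivShrink _).symm Γ).1

theorem evC_K (Γ : s.Ctx') : s.K (.ctx (s.evC Γ)) := ((equivShrink _).symm Γ).2

noncomputable def mkC (X : P.Ctx) (h : s.K (.ctx X)) : s.Ctx' := equivShrink _ ⟨X, h⟩

@[simp] theorem evC_mkC (X : P.Ctx) (h : s.K (.ctx X)) : s.evC (s.mkC X h) = X := by
  simp [evC, mkC]

theorem evC_inj {Γ Δ : s.Ctx'} (h : s.evC Γ = s.evC Δ) : Γ = Δ :=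
  (equivShrink _).symm.injective (Subtype.ext h)

def Hom' (Δ Γ : s.Ctx') : Type u := Shrink.{u} {h : P.Hom (s.evC Δ) (s.evC Γ) // s.K (.hom h)}

noncomputable def evH {Δ Γ : s.Ctx'} (h : s.Hom' Δ Γ) : P.Hom (s.evC Δ) (s.evC Γ) :=
  ((equivShrink _).symm h).1

theorem evH_K {Δ Γ : s.Ctx'} (h : s.Hom' Δ Γ) : s.K (.hom (s.evH h)) :=
  ((equivShrink _).symm h).2

theorem evH_inj {Δ Γ : s.Ctx'} {h h' : s.Hom' Δ Γ} (e : s.evH h = s.evH h') : h = h' :=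
  (equivShrink _).symm.injective (Subtype.ext e)

theorem exH {X Y : P.Ctx} (h : P.Hom X Y) (hk : s.K (.hom h)) {Δ Γ : s.Ctx'}
    (e1 : s.evC Δ = X) (e2 : s.evC Γ = Y) : ∃ h' : s.Hom' Δ Γ, HEq (s.evH h') h := by
  subst e1 e2
  exact ⟨equivShrink _ ⟨h, hk⟩, by simp [evH]⟩

noncomputable def mkH {X Y : P.Ctx} (h : P.Hom X Y) (hk : s.K (.hom h)) {Δ Γ : s.Ctx'}
    (e1 : s.evC Δ = X) (e2 : s.evC Γ = Y) : s.Hom' Δ Γ := (s.exH h hk e1 e2).choose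

theorem evH_mkH {X Y : P.Ctx} (h : P.Hom X Y) (hk : s.K (.hom h)) {Δ Γ : s.Ctx'}
    (e1 : s.evC Δ = X) (e2 : s.evC Γ = Y) : HEq (s.evH (s.mkH h hk e1 e2)) h :=
  (s.exH h hk e1 e2).choose_spec

def Ty' (Γ : s.Ctx') : Type u := Shrink.{u} {A : P.Ty (s.evC Γ) // s.K (.ty A)}

noncomputable def evT {Γ : s.Ctx'} (A : s.Ty' Γ) : P.Ty (s.evC Γ) := ((equivShrink _).symm A).1

theorem evT_K {Γ : s.Ctx'} (A : s.Ty' Γ) : s.K (.ty (s.evT A)) := ((equivShrink _).symm A).2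

theorem evT_inj {Γ : s.Ctx'} {A B : s.Ty' Γ} (e : s.evT A = s.evT B) : A = B :=
  (equivShrink _).symm.injective (Subtype.ext e)

theorem exT {X : P.Ctx} (A : P.Ty X) (hk : s.K (.ty A)) {Γ : s.Ctx'}
    (e1 : s.evC Γ = X) : ∃ A' : s.Ty' Γ, HEq (s.evT A') A := by
  subst e1
  exact ⟨equivShrink _ ⟨A, hk⟩, by simp [evT]⟩

noncomputable def mkT {X : P.Ctx} (A : P.Ty X) (hk : s.K (.ty A)) {Γ : s.Ctx'}
    (e1 : s.evC Γ = X) : s.Ty' Γ := (s.exT A hk e1).choose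

theorem evT_mkT {X : P.Ctx} (A : P.Ty X) (hk : s.K (.ty A)) {Γ : s.Ctx'}
    (e1 : s.evC Γ = X) : HEq (s.evT (s.mkT A hk e1)) A := (s.exT A hk e1).choose_spec

def Tm' (Γ : s.Ctx') (A : s.Ty' Γ) : Type u :=
  Shrink.{u} {a : P.Tm (s.evC Γ) (s.evT A) // s.K (.tm a)}

noncomputable def evt {Γ : s.Ctx'} {A : s.Ty' Γ} (a : s.Tm' Γ A) : P.Tm (s.evC Γ) (s.evT A) :=
  ((equivShrink _).symm a).1

theorem evt_K {Γ : s.Ctx'} {A : s.Ty' Γ} (a : s.Tm' Γ A) : s.K (.tm (s.evt a)) :=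
  ((equivShrink _).symm a).2

theorem evt_inj {Γ : s.Ctx'} {A B : s.Ty' Γ} {a : s.Tm' Γ A} {b : s.Tm' Γ B} (hAB : A = B)
    (e : HEq (s.evt a) (s.evt b)) : HEq a b := by
  subst hAB
  exact heq_of_eq ((equivShrink _).symm.injective (Subtype.ext (eq_of_heq e)))

theorem exTm {X : P.Ctx} {A : P.Ty X} (a : P.Tm X A) (hk : s.K (.tm a)) {Γ : s.Ctx'}
    {B : s.Ty' Γ} (e1 : s.evC Γ = X) (e2 : HEq (s.evT B) A) :
    ∃ a' : s.Tm' Γ B, HEq (s.evt a') a := by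
  subst e1; cases e2
  exact ⟨equivShrink _ ⟨a, hk⟩, by simp [evt]⟩

noncomputable def mkt {X : P.Ctx} {A : P.Ty X} (a : P.Tm X A) (hk : s.K (.tm a)) {Γ : s.Ctx'}
    {B : s.Ty' Γ} (e1 : s.evC Γ = X) (e2 : HEq (s.evT B) A) : s.Tm' Γ B :=
  (s.exTm a hk e1 e2).choose

theorem evt_mkt {X : P.Ctx} {A : P.Ty X} (a : P.Tm X A) (hk : s.K (.tm a)) {Γ : s.Ctx'}
    {B : s.Ty' Γ} (e1 : s.evC Γ = X) (e2 : HEq (s.evT B) A) :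
    HEq (s.evt (s.mkt a hk e1 e2)) a :=
  (s.exTm a hk e1 e2).choose_spec

noncomputable def id' (Γ : s.Ctx') : s.Hom' Γ Γ := s.mkH (P.id _) (s.id (s.evC_K Γ)) rfl rfl

theorem ev_id (Γ : s.Ctx') : s.evH (s.id' Γ) = P.id _ := eq_of_heq (s.evH_mkH _ _ _ _)

noncomputable def comp' {Ξ Δ Γ : s.Ctx'} (γ : s.Hom' Δ Γ) (δ : s.Hom' Ξ Δ) : s.Hom' Ξ Γ :=
  s.mkH (P.comp (s.evH γ) (s.evH δ)) (s.comp (s.evH_K _) (s.evH_K _)) rfl rfl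

theorem ev_comp {Ξ Δ Γ : s.Ctx'} (γ : s.Hom' Δ Γ) (δ : s.Hom' Ξ Δ) :
    s.evH (s.comp' γ δ) = P.comp (s.evH γ) (s.evH δ) := eq_of_heq (s.evH_mkH _ _ _ _)

noncomputable def subTy' {Δ Γ : s.Ctx'} (A : s.Ty' Γ) (γ : s.Hom' Δ Γ) : s.Ty' Δ :=
  s.mkT (P.subTy (s.evT A) (s.evH γ)) (s.subTy (s.evT_K _) (s.evH_K _)) rfl

theorem ev_subTy {Δ Γ : s.Ctx'} (A : s.Ty' Γ) (γ : s.Hom' Δ Γ) :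
    s.evT (s.subTy' A γ) = P.subTy (s.evT A) (s.evH γ) := eq_of_heq (s.evT_mkT _ _ _)

noncomputable def subTm' {Δ Γ : s.Ctx'} {A : s.Ty' Γ} (a : s.Tm' Γ A) (γ : s.Hom' Δ Γ) :
    s.Tm' Δ (s.subTy' A γ) :=
  s.mkt (P.subTm (s.evt a) (s.evH γ)) (s.subTm (s.evt_K _) (s.evH_K _)) rfl
    (heq_of_eq (s.ev_subTy A γ))

theorem ev_subTm {Δ Γ : s.Ctx'} {A : s.Ty' Γ} (a : s.Tm' Γ A) (γ : s.Hom' Δ Γ) :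
    HEq (s.evt (s.subTm' a γ)) (P.subTm (s.evt a) (s.evH γ)) := s.evt_mkt _ _ _ _

noncomputable def ext' (Γ : s.Ctx') (A : s.Ty' Γ) : s.Ctx' :=
  s.mkC (P.ext _ (s.evT A)) (s.ext (s.evT_K A))

theorem ev_ext (Γ : s.Ctx') (A : s.Ty' Γ) : s.evC (s.ext' Γ A) = P.ext _ (s.evT A) :=
  s.evC_mkC _ _

noncomputable def p' {Γ : s.Ctx'} (A : s.Ty' Γ) : s.Hom' (s.ext' Γ A) Γ :=
  s.mkH (P.p (s.evT A)) (s.p (s.evT_K A)) (s.ev_ext Γ A) rfl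

theorem ev_p {Γ : s.Ctx'} (A : s.Ty' Γ) : HEq (s.evH (s.p' A)) (P.p (s.evT A)) :=
  s.evH_mkH _ _ _ _

theorem ev_subTy_p {Γ : s.Ctx'} (A : s.Ty' Γ) :
    HEq (s.evT (s.subTy' A (s.p' A))) (P.subTy (s.evT A) (P.p (s.evT A))) :=
  (heq_of_eq (s.ev_subTy _ _)).trans (subTy_congr P (s.ev_ext Γ A) rfl HEq.rfl (s.ev_p A))

noncomputable def q' {Γ : s.Ctx'} (A : s.Ty' Γ) : s.Tm' (s.ext' Γ A) (s.subTy' A (s.p' A)) :=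
  s.mkt (P.q (s.evT A)) (s.q (s.evT_K A)) (s.ev_ext Γ A) (s.ev_subTy_p A)

theorem ev_q {Γ : s.Ctx'} (A : s.Ty' Γ) : HEq (s.evt (s.q' A)) (P.q (s.evT A)) :=
  s.evt_mkt _ _ _ _

theorem K_cast {X : P.Ctx} {A B : P.Ty X} (h : A = B) (a : P.Tm X A) (hk : s.K (.tm a)) :
    s.K (.tm (cast (congrArg (P.Tm X) h) a)) := by
  subst h; exact hk

/-- Evaluation of a term at a substituted type, with the type rewritten. -/
noncomputable def evs {Δ Γ : s.Ctx'} {A : s.Ty' Γ} {γ : s.Hom' Δ Γ} (a : s.Tm' Δ (s.subTy' A γ)) :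
    P.Tm (s.evC Δ) (P.subTy (s.evT A) (s.evH γ)) :=
  cast (congrArg (P.Tm _) (s.ev_subTy A γ)) (s.evt a)

theorem evs_heq {Δ Γ : s.Ctx'} {A : s.Ty' Γ} {γ : s.Hom' Δ Γ} (a : s.Tm' Δ (s.subTy' A γ)) :
    HEq (s.evs a) (s.evt a) := cast_heq _ _

noncomputable def pair' {Δ Γ : s.Ctx'} (A : s.Ty' Γ) (γ : s.Hom' Δ Γ)
    (a : s.Tm' Δ (s.subTy' A γ)) : s.Hom' Δ (s.ext' Γ A) :=
  s.mkH (P.pair (s.evT A) (s.evH γ) (s.evs a))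
    (s.pair (s.evT_K A) (s.evH_K γ) (s.K_cast (s.ev_subTy A γ) _ (s.evt_K a))) rfl (s.ev_ext Γ A)

theorem ev_pair {Δ Γ : s.Ctx'} (A : s.Ty' Γ) (γ : s.Hom' Δ Γ) (a : s.Tm' Δ (s.subTy' A γ)) :
    HEq (s.evH (s.pair' A γ a)) (P.pair (s.evT A) (s.evH γ) (s.evs a)) :=
  s.evH_mkH _ _ _ _

theorem subTy_comp' {Ξ Δ Γ : s.Ctx'} (A : s.Ty' Γ) (γ : s.Hom' Δ Γ) (δ : s.Hom' Ξ Δ) :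
    s.subTy' A (s.comp' γ δ) = s.subTy' (s.subTy' A γ) δ := s.evT_inj (by
  rw [ev_subTy, ev_subTy, ev_subTy, ev_comp, P.subTy_comp])

theorem subTy_id' {Γ : s.Ctx'} (A : s.Ty' Γ) : s.subTy' A (s.id' Γ) = A := s.evT_inj (by
  rw [ev_subTy, ev_id, P.subTy_id])

theorem p_pair' {Δ Γ : s.Ctx'} (A : s.Ty' Γ) (γ : s.Hom' Δ Γ) (a : s.Tm' Δ (s.subTy' A γ)) :
    s.comp' (s.p' A) (s.pair' A γ a) = γ := s.evH_inj (by
  rw [ev_comp]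
  apply eq_of_heq
  refine (comp_congr P rfl (s.ev_ext Γ A) rfl (s.ev_p A) (s.ev_pair A γ a)).trans ?_
  rw [P.p_pair])

/-- The small sub-cwf. -/
noncomputable def toCwF : CwF.{u, u, u, u} where
  Ctx := s.Ctx'
  Hom := s.Hom'
  id := s.id'
  comp := s.comp'
  id_comp γ := s.evH_inj (by rw [ev_comp, ev_id, P.id_comp])
  comp_id γ := s.evH_inj (by rw [ev_comp, ev_id, P.comp_id])
  comp_assoc γ δ ξ := s.evH_inj (by simp only [ev_comp, P.comp_assoc])
  Ty := s.Ty'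
  Tm := s.Tm'
  subTy := s.subTy'
  subTm := s.subTm'
  subTy_id := s.subTy_id'
  subTy_comp := s.subTy_comp'
  subTm_id a := s.evt_inj (s.subTy_id' _) (by
    refine (s.ev_subTm _ _).trans ?_
    rw [ev_id]
    exact P.subTm_id _)
  subTm_comp a γ δ := s.evt_inj (s.subTy_comp' _ _ _) (by
    refine (s.ev_subTm _ _).trans ?_
    rw [ev_comp]
    refine (P.subTm_comp _ _ _).trans ?_
    refine HEq.trans ?_ (s.ev_subTm _ _).symm
    exact subTm_congr P rfl rfl (heq_of_eq (s.ev_subTy _ _).symm) (s.ev_subTm _ _).symm HEq.rfl)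
  one := s.mkC P.one s.one
  bang Γ := s.mkH (P.bang (s.evC Γ)) (s.bang (s.evC_K Γ)) rfl (s.evC_mkC _ _)
  bang_unique γ := s.evH_inj (eq_of_heq
    ((bang_heq P (s.evC_mkC _ _) _).trans (s.evH_mkH _ _ _ _).symm))
  ext := s.ext'
  p := s.p'
  q := s.q'
  pair := s.pair'
  p_pair := s.p_pair'
  q_pair A γ a := s.evt_inj (by rw [← subTy_comp', p_pair']) (by
    refine (s.ev_subTm _ _).trans ?_
    refine (subTm_congr P rfl (s.ev_ext _ A) (s.ev_subTy_p A) (s.ev_q A)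
      (s.ev_pair A γ a)).trans ?_
    exact (P.q_pair _ _ _).trans (s.evs_heq a))
  pair_unique A γ a δ h1 h2 := s.evH_inj (by
    apply eq_of_heq
    refine HEq.trans ?_ (s.ev_pair A γ a).symm
    refine pair_heq P _ _ _ (s.ev_ext _ A) _ (s.ev_p A) _ (s.evt (s.q' A)) (s.ev_subTy_p A)
      (s.ev_q A) _ ?_ ?_
    · rw [← ev_comp, h1]
    · refine HEq.trans (s.ev_subTm _ _).symm (HEq.trans ?_ (s.evs_heq a).symm)
      have hT : s.subTy' (s.subTy' A (s.p' A)) δ = s.subTy' A γ := by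
        rw [← subTy_comp', h1]
      clear h1
      generalize s.subTm' (s.q' A) δ = b at h2
      revert b
      rw [hT]
      intro b h2
      cases h2
      rfl)

/-- The inclusion of the small sub-cwf. -/
noncomputable def incl : CwFHom s.toCwF P where
  obj := s.evC
  map := s.evH
  map_id := s.ev_id
  map_comp := s.ev_comp
  mapTy := s.evT
  mapTm := s.evt
  mapTy_sub := s.ev_subTy
  mapTm_sub := s.ev_subTm
  obj_one := s.evC_mkC _ _
  obj_ext := s.ev_ext _
  map_p := s.ev_p
  map_q := s.ev_q

end Sub

namespace Sub

variable {P : CwF.{v, v, v, v}} (s : Sub.{u, v} P)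

theorem evH_inj' {Δ Γ Δ' Γ' : s.Ctx'} {h : s.Hom' Δ Γ} {h' : s.Hom' Δ' Γ'} (e1 : Δ = Δ')
    (e2 : Γ = Γ') (e : HEq (s.evH h) (s.evH h')) : HEq h h' := by
  subst e1 e2; exact heq_of_eq (s.evH_inj (eq_of_heq e))

theorem evT_inj' {Γ Γ' : s.Ctx'} {A : s.Ty' Γ} {A' : s.Ty' Γ'}
    (e2 : Γ = Γ') (e : HEq (s.evT A) (s.evT A')) : HEq A A' := by
  subst e2; exact heq_of_eq (s.evT_inj (eq_of_heq e))

theorem evt_inj' {Γ Γ' : s.Ctx'} {A : s.Ty' Γ} {A' : s.Ty' Γ'} {a : s.Tm' Γ A} {a' : s.Tm' Γ' A'}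
    (e2 : Γ = Γ') (eA : HEq A A') (e : HEq (s.evt a) (s.evt a')) : HEq a a' := by
  subst e2; cases eA; exact s.evt_inj rfl e

/-- Factoring a morphism through a small sub-cwf. -/
noncomputable def factor {I : CwF.{u', v', w', x'}} (G : CwFHom I P)
    (h1 : ∀ X, s.K (.ctx (G.obj X))) (h2 : ∀ {X Y} (f : I.Hom X Y), s.K (.hom (G.map f)))
    (h3 : ∀ {X} (A : I.Ty X), s.K (.ty (G.mapTy A)))
    (h4 : ∀ {X} {A : I.Ty X} (a : I.Tm X A), s.K (.tm (G.mapTm a))) : CwFHom I s.toCwF :=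
  have hsub : ∀ {Δ Γ : I.Ctx} (A : I.Ty Γ) (γ : I.Hom Δ Γ),
      s.mkT (G.mapTy (I.subTy A γ)) (h3 _) (s.evC_mkC _ (h1 _)) =
      s.subTy' (s.mkT (G.mapTy A) (h3 _) (s.evC_mkC _ (h1 _)))
        (s.mkH (G.map γ) (h2 γ) (s.evC_mkC _ (h1 _)) (s.evC_mkC _ (h1 _))) := by
    intro Δ Γ A γ
    apply s.evT_inj
    apply eq_of_heq
    refine (s.evT_mkT _ _ _).trans ?_
    rw [ev_subTy, G.mapTy_sub]
    exact subTy_congr P (s.evC_mkC _ _).symm (s.evC_mkC _ _).symm (s.evT_mkT _ _ _).symm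
      (s.evH_mkH _ _ _ _).symm
  have hext : ∀ {Γ : I.Ctx} (A : I.Ty Γ), s.mkC (G.obj (I.ext Γ A)) (h1 _) =
      s.ext' (s.mkC (G.obj Γ) (h1 _)) (s.mkT (G.mapTy A) (h3 _) (s.evC_mkC _ (h1 _))) := by
    intro Γ A
    apply s.evC_inj
    rw [ev_ext, evC_mkC, G.obj_ext]
    exact ext_congr P (s.evC_mkC _ _).symm (s.evT_mkT _ _ _).symm
  have hp : ∀ {Γ : I.Ctx} (A : I.Ty Γ),
      HEq (s.mkH (G.map (I.p A)) (h2 _) (s.evC_mkC _ (h1 _)) (s.evC_mkC _ (h1 _)))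
        (s.p' (s.mkT (G.mapTy A) (h3 _) (s.evC_mkC _ (h1 _)))) := by
    intro Γ A
    refine s.evH_inj' (hext A) rfl ?_
    refine (s.evH_mkH _ _ _ _).trans (HEq.trans ?_ (s.ev_p _).symm)
    exact (G.map_p A).trans (p_congr P (s.evC_mkC _ _).symm (s.evT_mkT _ _ _).symm)
  { obj := fun X => s.mkC (G.obj X) (h1 X)
    map := fun f => s.mkH (G.map f) (h2 f) (s.evC_mkC _ _) (s.evC_mkC _ _)
    map_id := fun X => s.evH_inj (eq_of_heq (by
      refine (s.evH_mkH _ _ _ _).trans ?_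
      change HEq _ (s.evH (s.id' _))
      rw [G.map_id, ev_id]
      exact id_congr P (s.evC_mkC _ _).symm))
    map_comp := fun f g => s.evH_inj (eq_of_heq (by
      refine (s.evH_mkH _ _ _ _).trans ?_
      change HEq _ (s.evH (s.comp' _ _))
      rw [G.map_comp, ev_comp]
      exact comp_congr P (s.evC_mkC _ _).symm (s.evC_mkC _ _).symm (s.evC_mkC _ _).symm
        (s.evH_mkH _ _ _ _).symm (s.evH_mkH _ _ _ _).symm))
    mapTy := fun A => s.mkT (G.mapTy A) (h3 A) (s.evC_mkC _ _)
    mapTm := fun a => s.mkt (G.mapTm a) (h4 a) (s.evC_mkC _ _) (s.evT_mkT _ _ _)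
    mapTy_sub := hsub
    mapTm_sub := fun a γ => by
      refine s.evt_inj' rfl (heq_of_eq (hsub _ _)) ?_
      refine (s.evt_mkt _ _ _ _).trans (HEq.trans ?_ (s.ev_subTm _ _).symm)
      exact (G.mapTm_sub a γ).trans (subTm_congr P (s.evC_mkC _ _).symm (s.evC_mkC _ _).symm
        (s.evT_mkT _ _ _).symm (s.evt_mkt _ _ _ _).symm (s.evH_mkH _ _ _ _).symm)
    obj_one := s.evC_inj (by
      change _ = s.evC (s.mkC _ _)
      rw [evC_mkC, evC_mkC, G.obj_one])
    obj_ext := hext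
    map_p := hp
    map_q := fun A => by
      refine s.evt_inj' (hext A) ?_ ?_
      · exact (heq_of_eq (hsub _ _)).trans
          (subTy_congr s.toCwF (hext A) rfl HEq.rfl (hp A))
      · refine (s.evt_mkt _ _ _ _).trans (HEq.trans ?_ (s.ev_q _).symm)
        exact (G.map_q A).trans (q_congr P (s.evC_mkC _ _).symm (s.evT_mkT _ _ _).symm) }

end Sub

/-! ### Agreement of two morphisms -/

section Agree

variable {C : CwF.{u, v, w, x}} {D : CwF.{u', v', w', x'}} (F G : CwFHom C D)

def AgrH {Δ Γ : C.Ctx} (h : C.Hom Δ Γ) : Prop :=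
  F.obj Δ = G.obj Δ ∧ F.obj Γ = G.obj Γ ∧ HEq (F.map h) (G.map h)

def AgrT {Γ : C.Ctx} (A : C.Ty Γ) : Prop :=
  F.obj Γ = G.obj Γ ∧ HEq (F.mapTy A) (G.mapTy A)

def Agrt {Γ : C.Ctx} {A : C.Ty Γ} (a : C.Tm Γ A) : Prop :=
  F.obj Γ = G.obj Γ ∧ HEq (F.mapTy A) (G.mapTy A) ∧ HEq (F.mapTm a) (G.mapTm a)

variable {F G}

theorem agr_one : F.obj C.one = G.obj C.one := by rw [F.obj_one, G.obj_one]

theorem agr_id {Γ : C.Ctx} (h : F.obj Γ = G.obj Γ) : AgrH F G (C.id Γ) :=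
  ⟨h, h, by rw [F.map_id, G.map_id]; exact id_congr D h⟩

theorem agr_comp {Ξ Δ Γ : C.Ctx} {γ : C.Hom Δ Γ} {δ : C.Hom Ξ Δ} (h1 : AgrH F G γ)
    (h2 : AgrH F G δ) : AgrH F G (C.comp γ δ) :=
  ⟨h2.1, h1.2.1, by
    rw [F.map_comp, G.map_comp]; exact comp_congr D h2.1 h1.1 h1.2.1 h1.2.2 h2.2.2⟩

theorem agr_subTy {Δ Γ : C.Ctx} {A : C.Ty Γ} {γ : C.Hom Δ Γ} (h1 : AgrT F G A)
    (h2 : AgrH F G γ) : AgrT F G (C.subTy A γ) :=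
  ⟨h2.1, by rw [F.mapTy_sub, G.mapTy_sub]; exact subTy_congr D h2.1 h1.1 h1.2 h2.2.2⟩

theorem agr_subTm {Δ Γ : C.Ctx} {A : C.Ty Γ} {a : C.Tm Γ A} {γ : C.Hom Δ Γ} (h1 : Agrt F G a)
    (h2 : AgrH F G γ) : Agrt F G (C.subTm a γ) :=
  ⟨h2.1, (agr_subTy ⟨h1.1, h1.2.1⟩ h2).2, (F.mapTm_sub a γ).trans
    ((subTm_congr D h2.1 h1.1 h1.2.1 h1.2.2 h2.2.2).trans (G.mapTm_sub a γ).symm)⟩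

theorem agr_bang {Γ : C.Ctx} (h : F.obj Γ = G.obj Γ) : AgrH F G (C.bang Γ) :=
  ⟨h, agr_one, (map_bang F Γ).trans ((bang_congr D h).trans (map_bang G Γ).symm)⟩

theorem agr_ext {Γ : C.Ctx} {A : C.Ty Γ} (h1 : AgrT F G A) :
    F.obj (C.ext Γ A) = G.obj (C.ext Γ A) := by
  rw [F.obj_ext, G.obj_ext]; exact ext_congr D h1.1 h1.2

theorem agr_p {Γ : C.Ctx} {A : C.Ty Γ} (h1 : AgrT F G A) : AgrH F G (C.p A) :=
  ⟨agr_ext h1, h1.1, (F.map_p A).trans ((p_congr D h1.1 h1.2).trans (G.map_p A).symm)⟩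

theorem agr_q {Γ : C.Ctx} {A : C.Ty Γ} (h1 : AgrT F G A) : Agrt F G (C.q A) :=
  ⟨agr_ext h1, (agr_subTy h1 (agr_p h1)).2,
    (F.map_q A).trans ((q_congr D h1.1 h1.2).trans (G.map_q A).symm)⟩

theorem agr_pair {Δ Γ : C.Ctx} {A : C.Ty Γ} {γ : C.Hom Δ Γ} {a : C.Tm Δ (C.subTy A γ)}
    (h1 : AgrT F G A) (h2 : AgrH F G γ) (h3 : Agrt F G a) : AgrH F G (C.pair A γ a) := by
  refine ⟨h2.1, agr_ext h1, ?_⟩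
  have hF := map_pair F A γ a (cast (congrArg (D.Tm _) (F.mapTy_sub A γ)) (F.mapTm a))
    (cast_heq _ _).symm
  have hG := map_pair G A γ a (cast (congrArg (D.Tm _) (G.mapTy_sub A γ)) (G.mapTm a))
    (cast_heq _ _).symm
  refine hF.trans (HEq.trans ?_ hG.symm)
  exact pair_congr D h2.1 h1.1 h1.2 h2.2.2
    ((cast_heq _ _).trans (h3.2.2.trans (cast_heq _ _).symm))

end Agree

/-! ### The generated sub-cwf -/

/-- Codes for elements of a cwf generated by `I` and one new type. -/
inductive Code (I : CwF.{u, u, u, u}) : Type u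
  | gen (v : V I) : Code I
  | sort : Code I
  | one : Code I
  | id (a : Code I) : Code I
  | comp (a b : Code I) : Code I
  | subTy (a b : Code I) : Code I
  | subTm (a b : Code I) : Code I
  | bang (a : Code I) : Code I
  | ext (a : Code I) : Code I
  | p (a : Code I) : Code I
  | q (a : Code I) : Code I
  | pair (a b c : Code I) : Code I

/-- The evaluation relation for codes. -/
inductive Rel {I : CwF.{u, u, u, u}} {P : CwF.{v, v, v, v}} (G : CwFHom I P) {Γ₀ : I.Ctx}
    (T : P.Ty (G.obj Γ₀)) : Code I → V P → Prop
  | gctx (X : I.Ctx) : Rel G T (.gen (.ctx X)) (.ctx (G.obj X))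
  | ghom {X Y : I.Ctx} (f : I.Hom X Y) : Rel G T (.gen (.hom f)) (.hom (G.map f))
  | gty {X : I.Ctx} (A : I.Ty X) : Rel G T (.gen (.ty A)) (.ty (G.mapTy A))
  | gtm {X : I.Ctx} {A : I.Ty X} (a : I.Tm X A) : Rel G T (.gen (.tm a)) (.tm (G.mapTm a))
  | sort : Rel G T .sort (.ty T)
  | one : Rel G T .one (.ctx P.one)
  | id {c : Code I} {X : P.Ctx} : Rel G T c (.ctx X) → Rel G T (.id c) (.hom (P.id X))
  | comp {c d : Code I} {Ξ Δ Γ : P.Ctx} {γ : P.Hom Δ Γ} {δ : P.Hom Ξ Δ} :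
      Rel G T c (.hom γ) → Rel G T d (.hom δ) → Rel G T (.comp c d) (.hom (P.comp γ δ))
  | subTy {c d : Code I} {Δ Γ : P.Ctx} {A : P.Ty Γ} {γ : P.Hom Δ Γ} :
      Rel G T c (.ty A) → Rel G T d (.hom γ) → Rel G T (.subTy c d) (.ty (P.subTy A γ))
  | subTm {c d : Code I} {Δ Γ : P.Ctx} {A : P.Ty Γ} {a : P.Tm Γ A} {γ : P.Hom Δ Γ} :
      Rel G T c (.tm a) → Rel G T d (.hom γ) → Rel G T (.subTm c d) (.tm (P.subTm a γ))
  | bang {c : Code I} {X : P.Ctx} : Rel G T c (.ctx X) → Rel G T (.bang c) (.hom (P.bang X))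
  | ext {c : Code I} {Γ : P.Ctx} {A : P.Ty Γ} :
      Rel G T c (.ty A) → Rel G T (.ext c) (.ctx (P.ext Γ A))
  | p {c : Code I} {Γ : P.Ctx} {A : P.Ty Γ} : Rel G T c (.ty A) → Rel G T (.p c) (.hom (P.p A))
  | q {c : Code I} {Γ : P.Ctx} {A : P.Ty Γ} : Rel G T c (.ty A) → Rel G T (.q c) (.tm (P.q A))
  | pair {c d e : Code I} {Δ Γ : P.Ctx} {A : P.Ty Γ} {γ : P.Hom Δ Γ}
      {a : P.Tm Δ (P.subTy A γ)} :
      Rel G T c (.ty A) → Rel G T d (.hom γ) → Rel G T e (.tm a) →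
      Rel G T (.pair c d e) (.hom (P.pair A γ a))

theorem Rel.functional {I : CwF.{u, u, u, u}} {P : CwF.{v, v, v, v}} {G : CwFHom I P} {Γ₀ : I.Ctx}
    {T : P.Ty (G.obj Γ₀)} {c : Code I} {v : V P} (h : Rel G T c v) :
    ∀ {v' : V P}, Rel G T c v' → v = v' := by
  induction h with
  | gctx | ghom | gty | gtm | sort | one => intro v' h'; cases h'; rfl
  | id _ ih | bang _ ih | ext _ ih | p _ ih | q _ ih =>
    intro v' h'
    cases h'; rename_i h1; cases ih h1; rfl
  | comp _ _ ih1 ih2 | subTy _ _ ih1 ih2 | subTm _ _ ih1 ih2 =>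
    intro v' h'
    cases h'; rename_i h1 h2; cases ih1 h1; cases ih2 h2; rfl
  | pair _ _ _ ih1 ih2 ih3 =>
    intro v' h'
    cases h'; rename_i h1 h2 h3; cases ih1 h1; cases ih2 h2; cases ih3 h3; rfl

/-- The small sub-cwf generated by the image of `G` and by `T`. -/
def genSub {I : CwF.{u, u, u, u}} {P : CwF.{v, v, v, v}} (G : CwFHom I P) {Γ₀ : I.Ctx}
    (T : P.Ty (G.obj Γ₀)) : Sub.{u, v} P where
  K v := ∃ c, Rel G T c v
  small := by
    refine small_of_injective (β := Code I) (f := fun v => v.2.choose) ?_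
    intro a b h
    have h1 := a.2.choose_spec
    have h2 := b.2.choose_spec
    have h' : a.2.choose = b.2.choose := h
    rw [h'] at h1
    exact Subtype.ext (h1.functional h2)
  id := fun ⟨_, h⟩ => ⟨_, .id h⟩
  comp := fun ⟨_, h⟩ ⟨_, h'⟩ => ⟨_, .comp h h'⟩
  subTy := fun ⟨_, h⟩ ⟨_, h'⟩ => ⟨_, .subTy h h'⟩
  subTm := fun ⟨_, h⟩ ⟨_, h'⟩ => ⟨_, .subTm h h'⟩
  one := ⟨_, .one⟩
  bang := fun ⟨_, h⟩ => ⟨_, .bang h⟩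
  ext := fun ⟨_, h⟩ => ⟨_, .ext h⟩
  p := fun ⟨_, h⟩ => ⟨_, .p h⟩
  q := fun ⟨_, h⟩ => ⟨_, .q h⟩
  pair := fun ⟨_, h⟩ ⟨_, h'⟩ ⟨_, h''⟩ => ⟨_, .pair h h' h''⟩

section Gen

variable {I : CwF.{u, u, u, u}} {P : CwF.{v, v, v, v}} (G : CwFHom I P) {Γ₀ : I.Ctx}
    (T : P.Ty (G.obj Γ₀))

noncomputable def genHom : CwFHom I (genSub G T).toCwF :=
  (genSub G T).factor G (fun X => ⟨_, .gctx X⟩) (fun f => ⟨_, .ghom f⟩) (fun A => ⟨_, .gty A⟩)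
    (fun a => ⟨_, .gtm a⟩)

noncomputable def genT : (genSub G T).toCwF.Ty ((genHom G T).obj Γ₀) :=
  (genSub G T).mkT T ⟨_, .sort⟩ ((genSub G T).evC_mkC _ _)

theorem gen_obj (X : I.Ctx) : (genSub G T).evC ((genHom G T).obj X) = G.obj X :=
  Sub.evC_mkC _ _ _

theorem gen_map {X Y : I.Ctx} (f : I.Hom X Y) :
    HEq ((genSub G T).evH ((genHom G T).map f)) (G.map f) :=
  Sub.evH_mkH (genSub G T) (G.map f) ⟨_, .ghom f⟩ (gen_obj G T X) (gen_obj G T Y)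

theorem gen_ty {X : I.Ctx} (A : I.Ty X) :
    HEq ((genSub G T).evT ((genHom G T).mapTy A)) (G.mapTy A) :=
  Sub.evT_mkT (genSub G T) (G.mapTy A) ⟨_, .gty A⟩ (gen_obj G T X)

theorem gen_tm {X : I.Ctx} {A : I.Ty X} (a : I.Tm X A) :
    HEq ((genSub G T).evt ((genHom G T).mapTm a)) (G.mapTm a) :=
  Sub.evt_mkt (genSub G T) (G.mapTm a) ⟨_, .gtm a⟩ (gen_obj G T X) (gen_ty G T A)

/-- An element of `P` comes from an element of the sub-cwf on which `F` and `F'` agree. -/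
def Q (s : Sub.{u, v} P) {D : CwF.{u', v', w', x'}} (F F' : CwFHom s.toCwF D) : V P → Prop
  | .ctx X => ∃ X' : s.Ctx', F.obj X' = F'.obj X' ∧ s.evC X' = X
  | @V.hom _ Δ Γ h => ∃ (Δ' Γ' : s.Ctx') (h' : s.Hom' Δ' Γ'), AgrH F F' h' ∧
      s.evC Δ' = Δ ∧ s.evC Γ' = Γ ∧ HEq (s.evH h') h
  | @V.ty _ Γ A => ∃ (Γ' : s.Ctx') (A' : s.Ty' Γ'), AgrT F F' A' ∧
      s.evC Γ' = Γ ∧ HEq (s.evT A') A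
  | @V.tm _ Γ A a => ∃ (Γ' : s.Ctx') (A' : s.Ty' Γ') (a' : s.Tm' Γ' A'), Agrt F F' a' ∧
      s.evC Γ' = Γ ∧ HEq (s.evT A') A ∧ HEq (s.evt a') a

theorem Q_of_rel {D : CwF.{u', v', w', x'}} (F F' : CwFHom (genSub G T).toCwF D)
    (hG : homComp F (genHom G T) = homComp F' (genHom G T))
    (hT : HEq (F.mapTy (genT G T)) (F'.mapTy (genT G T))) {c : Code I} {v : V P}
    (h : Rel G T c v) : Q (genSub G T) F F' v := by
  have e1 : ∀ X, F.obj ((genHom G T).obj X) = F'.obj ((genHom G T).obj X) := fun X =>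
    congrArg (fun H : CwFHom I D => H.obj X) hG
  have e2 : ∀ {X Y} (f : I.Hom X Y),
      HEq (F.map ((genHom G T).map f)) (F'.map ((genHom G T).map f)) := fun f => by
    change HEq ((homComp F (genHom G T)).map f) ((homComp F' (genHom G T)).map f)
    rw [hG]
  have e3 : ∀ {X} (A : I.Ty X),
      HEq (F.mapTy ((genHom G T).mapTy A)) (F'.mapTy ((genHom G T).mapTy A)) := fun A => by
    change HEq ((homComp F (genHom G T)).mapTy A) ((homComp F' (genHom G T)).mapTy A)
    rw [hG]
  have e4 : ∀ {X} {A : I.Ty X} (a : I.Tm X A),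
      HEq (F.mapTm ((genHom G T).mapTm a)) (F'.mapTm ((genHom G T).mapTm a)) := fun a => by
    change HEq ((homComp F (genHom G T)).mapTm a) ((homComp F' (genHom G T)).mapTm a)
    rw [hG]
  induction h with
  | gctx X => exact ⟨(genHom G T).obj X, e1 X, Sub.evC_mkC _ _ _⟩
  | ghom f =>
    exact ⟨_, _, (genHom G T).map f, ⟨e1 _, e1 _, e2 f⟩, gen_obj G T _, gen_obj G T _, gen_map G T f⟩
  | gty A =>
    exact ⟨_, (genHom G T).mapTy A, ⟨e1 _, e3 A⟩, gen_obj G T _, gen_ty G T A⟩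
  | gtm a =>
    exact ⟨_, _, (genHom G T).mapTm a, ⟨e1 _, e3 _, e4 a⟩, gen_obj G T _, gen_ty G T _, gen_tm G T a⟩
  | sort => exact ⟨_, genT G T, ⟨e1 _, hT⟩, Sub.evC_mkC _ _ _, Sub.evT_mkT _ _ _ _⟩
  | one => exact ⟨_, agr_one, Sub.evC_mkC _ _ _⟩
  | id _ ih =>
    obtain ⟨X', h, rfl⟩ := ih
    exact ⟨_, _, _, agr_id h, rfl, rfl, heq_of_eq (Sub.ev_id _ _)⟩
  | comp _ _ ih1 ih2 =>
    obtain ⟨Δ', Γ', γ', h1, rfl, rfl, hγ⟩ := ih1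
    obtain ⟨Ξ', Δ'', δ', h2, rfl, e, hδ⟩ := ih2
    obtain rfl := Sub.evC_inj _ e
    obtain rfl := eq_of_heq hγ
    obtain rfl := eq_of_heq hδ
    exact ⟨_, _, _, agr_comp h1 h2, rfl, rfl, heq_of_eq (Sub.ev_comp _ _ _)⟩
  | subTy _ _ ih1 ih2 =>
    obtain ⟨Γ', A', h1, rfl, hA⟩ := ih1
    obtain ⟨Δ', Γ'', γ', h2, rfl, e, hγ⟩ := ih2
    obtain rfl := Sub.evC_inj _ e
    obtain rfl := eq_of_heq hA
    obtain rfl := eq_of_heq hγ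
    exact ⟨_, _, agr_subTy h1 h2, rfl, heq_of_eq (Sub.ev_subTy _ _ _)⟩
  | subTm _ _ ih1 ih2 =>
    obtain ⟨Γ', A', a', h1, rfl, hA, ha⟩ := ih1
    obtain ⟨Δ', Γ'', γ', h2, rfl, e, hγ⟩ := ih2
    obtain rfl := Sub.evC_inj _ e
    obtain rfl := eq_of_heq hA
    obtain rfl := eq_of_heq ha
    obtain rfl := eq_of_heq hγ
    exact ⟨_, _, _, agr_subTm h1 h2, rfl, heq_of_eq (Sub.ev_subTy _ _ _), Sub.ev_subTm _ _ _⟩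
  | bang _ ih =>
    obtain ⟨X', h, rfl⟩ := ih
    exact ⟨_, _, _, agr_bang h, rfl, Sub.evC_mkC _ _ _, map_bang (genSub G T).incl X'⟩
  | ext _ ih =>
    obtain ⟨Γ', A', h1, rfl, hA⟩ := ih
    obtain rfl := eq_of_heq hA
    exact ⟨_, agr_ext h1, Sub.ev_ext _ _ _⟩
  | p _ ih =>
    obtain ⟨Γ', A', h1, rfl, hA⟩ := ih
    obtain rfl := eq_of_heq hA
    exact ⟨_, _, _, agr_p h1, Sub.ev_ext _ _ _, rfl, Sub.ev_p _ _⟩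
  | q _ ih =>
    obtain ⟨Γ', A', h1, rfl, hA⟩ := ih
    obtain rfl := eq_of_heq hA
    exact ⟨_, _, _, agr_q h1, Sub.ev_ext _ _ _, Sub.ev_subTy_p _ _, Sub.ev_q _ _⟩
  | pair _ _ _ ih1 ih2 ih3 =>
    obtain ⟨Γ', A', h1, rfl, hA⟩ := ih1
    obtain ⟨Δ', Γ'', γ', h2, rfl, e, hγ⟩ := ih2
    obtain rfl := Sub.evC_inj _ e
    obtain rfl := eq_of_heq hA
    obtain rfl := eq_of_heq hγ
    obtain ⟨Δ'', B, a', h3, e', hB, ha⟩ := ih3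
    obtain rfl := Sub.evC_inj _ e'
    obtain rfl : B = (genSub G T).subTy' A' γ' := Sub.evT_inj _
      ((eq_of_heq hB).trans (Sub.ev_subTy _ _ _).symm)
    obtain rfl := eq_of_heq ((Sub.evs_heq _ a').trans ha)
    exact ⟨_, _, _, agr_pair h1 h2 h3, rfl, Sub.ev_ext _ _ _, Sub.ev_pair _ _ _ _⟩

theorem gen_unique {D : CwF.{u', v', w', x'}} (F F' : CwFHom (genSub G T).toCwF D)
    (hG : homComp F (genHom G T) = homComp F' (genHom G T))
    (hT : HEq (F.mapTy (genT G T)) (F'.mapTy (genT G T))) : F = F' := by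
  apply hom_ext
  · intro X
    obtain ⟨c, hc⟩ := (genSub G T).evC_K X
    obtain ⟨X', h, e⟩ := Q_of_rel G T F F' hG hT hc
    obtain rfl := Sub.evC_inj _ e
    exact h
  · intro X Y f
    obtain ⟨c, hc⟩ := (genSub G T).evH_K f
    obtain ⟨X', Y', f', h, e, e', hf⟩ := Q_of_rel G T F F' hG hT hc
    obtain rfl := Sub.evC_inj _ e
    obtain rfl := Sub.evC_inj _ e'
    obtain rfl := Sub.evH_inj _ (eq_of_heq hf)
    exact h.2.2
  · intro X A
    obtain ⟨c, hc⟩ := (genSub G T).evT_K A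
    obtain ⟨X', A', h, e, hA⟩ := Q_of_rel G T F F' hG hT hc
    obtain rfl := Sub.evC_inj _ e
    obtain rfl := Sub.evT_inj _ (eq_of_heq hA)
    exact h.2
  · intro X A a
    obtain ⟨c, hc⟩ := (genSub G T).evt_K a
    obtain ⟨X', A', a', h, e, hA, ha⟩ := Q_of_rel G T F F' hG hT hc
    obtain rfl := Sub.evC_inj _ e
    obtain rfl := Sub.evT_inj _ (eq_of_heq hA)
    obtain rfl := eq_of_heq (Sub.evt_inj _ rfl ha)
    exact h.2.2

theorem incl_gen : homComp (genSub G T).incl (genHom G T) = G :=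
  hom_ext (gen_obj G T) (gen_map G T) (gen_ty G T) (gen_tm G T)

theorem incl_genT : HEq ((genSub G T).incl.mapTy (genT G T)) T := Sub.evT_mkT _ _ _ _

end Gen

/-- Freely adjoining a type in context `Γ₀` to a cwf `I`. -/
theorem free_exists (I : CwF.{u, u, u, u}) (Γ₀ : I.Ctx) :
    ∃ (C : CwF.{u, u, u, u}) (G : CwFHom I C) (T : C.Ty (G.obj Γ₀)),
      ∀ (D : CwF.{u, u, u, u}) (H : CwFHom I D) (X : D.Ctx) (_ : H.obj Γ₀ = X) (U : D.Ty X),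
        ∃! F : CwFHom C D, homComp F G = H ∧ HEq (F.mapTy T) U := by
  let Mod := Σ (D : CwF.{u, u, u, u}) (G : CwFHom I D), D.Ty (G.obj Γ₀)
  let P : CwF.{u+1, u+1, u+1, u+1} := prod (fun i : Mod => i.1)
  let G : CwFHom I P := tuple (fun i : Mod => i.1) (fun i => i.2.1)
  let T : P.Ty (G.obj Γ₀) := fun i => i.2.2
  refine ⟨(genSub G T).toCwF, genHom G T, genT G T, ?_⟩
  rintro D H X rfl U
  let i : Mod := ⟨D, H, U⟩
  let π : CwFHom P D := proj (fun i : Mod => i.1) i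
  have h1 : homComp (homComp π (genSub G T).incl) (genHom G T) = H := by
    change homComp π (homComp (genSub G T).incl (genHom G T)) = H
    rw [incl_gen]
    rfl
  have h2 : HEq ((homComp π (genSub G T).incl).mapTy (genT G T)) U := by
    change HEq (π.mapTy ((genSub G T).incl.mapTy (genT G T))) (π.mapTy T)
    exact mapTy_congr π (Sub.evC_mkC _ _ _) (incl_genT G T)
  refine ⟨_, ⟨h1, h2⟩, ?_⟩
  rintro F ⟨hF1, hF2⟩
  exact gen_unique G T _ _ (hF1.trans h1.symm) (hF2.trans h2.symm)

/-! ### Valid signatures -/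

theorem mor_comp {S : SigCat.{u}} (hS : S.Valid) : ∀ {C D E : S.Obj}
    (F : CwFHom (S.cwf C) (S.cwf D)) (G : CwFHom (S.cwf D) (S.cwf E)),
    S.Mor C D F → S.Mor D E G → S.Mor C E (homComp G F) := by
  induction hS with
  | empty => intros; trivial
  | addSort S Γ _ ih =>
    intro C D E F G hF hG
    exact ⟨ih F G hF.1 hG.1, (mapTy_congr G (Γ.uniform F hF.1) hF.2).trans hG.2⟩
  | addOp S Γ A _ ih =>
    intro C D E F G hF hG
    exact ⟨ih F G hF.1 hG.1,
      (mapTm_congr G (Γ.uniform F hF.1) (A.uniform F hF.1) hF.2).trans hG.2⟩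
  | addEq S Γ A a a' _ ih =>
    intro C D E F G hF hG
    exact ih F G hF hG

theorem push_exists {S : SigCat.{u}} (hS : S.Valid) : ∀ (C : S.Obj) (D : CwF.{u, u, u, u})
    (F : CwFHom (S.cwf C) D), ∃ (D' : S.Obj) (F' : CwFHom (S.cwf C) (S.cwf D')),
      S.cwf D' = D ∧ HEq F' F ∧ S.Mor C D' F' := by
  induction hS with
  | empty => intro C D F; exact ⟨D, F, rfl, HEq.rfl, trivial⟩
  | addSort S Γ _ ih =>
    intro C D F
    obtain ⟨D', F', rfl, hF, hM⟩ := ih C.1 D F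
    obtain rfl := eq_of_heq hF
    exact ⟨⟨D', cast (congrArg _ (Γ.uniform F' hM)) (F'.mapTy C.2)⟩, F', rfl, HEq.rfl, hM,
      (cast_heq _ _).symm⟩
  | addOp S Γ A _ ih =>
    intro C D F
    obtain ⟨D', F', rfl, hF, hM⟩ := ih C.1 D F
    obtain rfl := eq_of_heq hF
    have hT : (S.cwf D').Tm (F'.obj (Γ.fam C.1)) (F'.mapTy (A.fam C.1)) =
        (S.cwf D').Tm (Γ.fam D') (A.fam D') := by
      congr 1
      · exact Γ.uniform F' hM
      · exact A.uniform F' hM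
    exact ⟨⟨D', cast hT (F'.mapTm C.2)⟩, F', rfl, HEq.rfl, hM, (cast_heq _ _).symm⟩
  | addEq S Γ A a a' _ ih =>
    intro C D F
    obtain ⟨D', F', rfl, hF, hM⟩ := ih C.1 D F
    obtain rfl := eq_of_heq hF
    refine ⟨⟨D', ?_⟩, F', rfl, HEq.rfl, hM⟩
    apply eq_of_heq
    refine (a.uniform F' hM).symm.trans (HEq.trans ?_ (a'.uniform F' hM))
    rw [C.2]

theorem push_unique {S : SigCat.{u}} (hS : S.Valid) : ∀ (C D₁ D₂ : S.Obj)
    (F₁ : CwFHom (S.cwf C) (S.cwf D₁)) (F₂ : CwFHom (S.cwf C) (S.cwf D₂)),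
    S.cwf D₁ = S.cwf D₂ → HEq F₁ F₂ → S.Mor C D₁ F₁ → S.Mor C D₂ F₂ → D₁ = D₂ := by
  induction hS with
  | empty => intro C D₁ D₂ F₁ F₂ h _ _ _; exact h
  | addSort S Γ _ ih =>
    rintro C ⟨D₁, t₁⟩ ⟨D₂, t₂⟩ F₁ F₂ h hF h1 h2
    obtain rfl : D₁ = D₂ := ih C.1 D₁ D₂ F₁ F₂ h hF h1.1 h2.1
    obtain rfl := eq_of_heq hF
    obtain rfl : t₁ = t₂ := eq_of_heq (h1.2.symm.trans h2.2)
    rfl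
  | addOp S Γ A _ ih =>
    rintro C ⟨D₁, t₁⟩ ⟨D₂, t₂⟩ F₁ F₂ h hF h1 h2
    obtain rfl : D₁ = D₂ := ih C.1 D₁ D₂ F₁ F₂ h hF h1.1 h2.1
    obtain rfl := eq_of_heq hF
    obtain rfl : t₁ = t₂ := eq_of_heq (h1.2.symm.trans h2.2)
    rfl
  | addEq S Γ A a a' _ ih =>
    rintro C ⟨D₁, t₁⟩ ⟨D₂, t₂⟩ F₁ F₂ h hF h1 h2
    obtain rfl : D₁ = D₂ := ih C.1 D₁ D₂ F₁ F₂ h hF h1 h2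
    rfl

/-- A cwf-morphism under a third object is structure-preserving if both legs are. -/
theorem mor_of_comp {S : SigCat.{u}} (hS : S.Valid) {I C D : S.Obj}
    (G : CwFHom (S.cwf I) (S.cwf C)) (F : CwFHom (S.cwf C) (S.cwf D))
    (hG : S.Mor I C G) (hFG : S.Mor I D (homComp F G)) : S.Mor C D F := by
  obtain ⟨D', F', hD, hF, hM⟩ := push_exists hS C (S.cwf D) F
  have h := mor_comp hS G F' hG hM
  have hh : HEq (homComp F' G) (homComp F G) := by
    clear h hM hFG
    generalize S.cwf D' = E at *
    subst hD
    cases hF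
    rfl
  obtain rfl := push_unique hS I D' D _ _ hD hh h hFG
  obtain rfl := eq_of_heq hF
  exact hM

theorem main (S : SigCat.{u}) (hS : S.Valid)
    (hI : ∃ I : S.Obj, S.IsInitial I) (Γ : UnifCtx S) :
    ∃ I' : (S.addSort Γ).Obj, (S.addSort Γ).IsInitial I' := by
  obtain ⟨I, hI⟩ := hI
  obtain ⟨C₀, G, T, hfree⟩ := free_exists (S.cwf I) (Γ.fam I)
  obtain ⟨C, G', rfl, hG, hM⟩ := push_exists hS I C₀ G
  obtain rfl := eq_of_heq hG
  refine ⟨⟨C, cast (congrArg _ (Γ.uniform G' hM)) T⟩, ?_⟩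
  rintro ⟨D, U⟩
  obtain ⟨H, hH, hHu⟩ := hI D
  obtain ⟨F, ⟨hF1, hF2⟩, hFu⟩ := hfree (S.cwf D) H _ (Γ.uniform H hH) U
  have hc : ∀ F' : CwFHom (S.cwf C) (S.cwf D),
      HEq (F'.mapTy (cast (congrArg _ (Γ.uniform G' hM)) T : (S.cwf C).Ty (Γ.fam C)))
        (F'.mapTy T) :=
    fun F' => mapTy_congr F' (Γ.uniform G' hM).symm (cast_heq _ _)
  refine ⟨F, ⟨mor_of_comp hS G' F hM (by rw [hF1]; exact hH), (hc F).trans hF2⟩, ?_⟩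
  rintro F' ⟨h1, h2⟩
  exact hFu F' ⟨hHu _ (mor_comp hS G' F' hM h1), (hc F').symm.trans h2⟩

end CwFree

/-- Sort-extension step of the initiality theorem: if `CwF_Σ` has an initial
object then so does `CwF_{Σ'}` for `Σ' = (Σ,(Γ,S))`, the extension of `Σ` by a
new sort symbol relative to a uniform family of contexts `Γ`. -/
theorem addSort_has_initial (S : SigCat.{u}) (hS : S.Valid)
    (hI : ∃ I : S.Obj, S.IsInitial I) (Γ : UnifCtx S) :
    ∃ I' : (S.addSort Γ).Obj, (S.addSort Γ).IsInitial I' := by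
  exact CwFree.main S hS hI Γ
end
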